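/- arXiv:0905.1294 — 9 statements merged into one kernel-verified Lean document; each statement's English description precedes it below -/
import Mathlib

section
/- Let r ≥ 1 be a natural number and define the sequence a_n = (2 + α_n)/n², where α_n = −1 if r ∣ n and α_n = 1 if r ∤ n. Then (a_n) belongs to GM(β*, r); more precisely, for every c > 1 there is a constant K > 0 such that for all m ≥ 1, ∑_{k=m}^{2m-1} |a_k − a_{k+r}| ≤ K·∑_{k=max(1,⌊m/c⌋)}^{⌊cm⌋} a_k/k. -/
open Finset

theorem abs_sub_shift_le {r : ℕ} {a : ℕ → ℝ}
    (ha : ∀ n : ℕ, a n = (2 + (if r ∣ n then (-1 : ℝ) else 1)) / (n : ℝ) ^ 2)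
    {k : ℕ} (hk : 1 ≤ k) : |a k - a (k + r)| ≤ 6 * r / (k : ℝ) ^ 3 := by
  have hk0 : (0 : ℝ) < k := by exact_mod_cast hk
  have hr0 : (0 : ℝ) ≤ r := r.cast_nonneg
  obtain ⟨s, hs0, hs3, h1, h2⟩ : ∃ s : ℝ, 0 ≤ s ∧ s ≤ 3 ∧ a k = s / (k : ℝ) ^ 2 ∧
      a (k + r) = s / ((k : ℝ) + r) ^ 2 := by
    refine ⟨2 + (if r ∣ k then (-1 : ℝ) else 1), ?_, ?_, ha k, ?_⟩
    · split_ifs <;> norm_num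
    · split_ifs <;> norm_num
    · simp [ha (k + r)]
  have hdiff : 1 / (k : ℝ) ^ 2 - 1 / ((k : ℝ) + r) ^ 2 ≤ 2 * r / (k : ℝ) ^ 3 := by
    have h : 2 * r / (k : ℝ) ^ 3 - (1 / (k : ℝ) ^ 2 - 1 / ((k : ℝ) + r) ^ 2) =
        (r * (3 * k * r + 2 * r ^ 2)) / ((k : ℝ) ^ 3 * ((k : ℝ) + r) ^ 2) := by
      field_simp
      ring
    have h' : 0 ≤ (r * (3 * k * r + 2 * r ^ 2)) / ((k : ℝ) ^ 3 * ((k : ℝ) + r) ^ 2) := by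
      positivity
    linarith
  have hnonneg : 0 ≤ 1 / (k : ℝ) ^ 2 - 1 / ((k : ℝ) + r) ^ 2 :=
    sub_nonneg.2 (by gcongr; linarith)
  have hfactor : a k - a (k + r) = s * (1 / (k : ℝ) ^ 2 - 1 / ((k : ℝ) + r) ^ 2) := by
    rw [h1, h2]
    ring
  rw [hfactor, abs_of_nonneg (mul_nonneg hs0 hnonneg)]
  calc s * (1 / (k : ℝ) ^ 2 - 1 / ((k : ℝ) + r) ^ 2) ≤ 3 * (2 * r / (k : ℝ) ^ 3) := by gcongr
    _ = 6 * r / (k : ℝ) ^ 3 := by ring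

theorem sum_abs_sub_shift_le {r : ℕ} {a : ℕ → ℝ}
    (ha : ∀ n : ℕ, a n = (2 + (if r ∣ n then (-1 : ℝ) else 1)) / (n : ℝ) ^ 2)
    {m : ℕ} (hm : 1 ≤ m) :
    ∑ k ∈ Finset.Icc m (2 * m - 1), |a k - a (k + r)| ≤ 6 * r / (m : ℝ) ^ 2 := by
  have hm0 : (0 : ℝ) < m := by exact_mod_cast hm
  have h : ∀ k ∈ Finset.Icc m (2 * m - 1), |a k - a (k + r)| ≤ 6 * r / (m : ℝ) ^ 3 := by
    intro k hk
    have hmk : m ≤ k := (Finset.mem_Icc.1 hk).1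
    refine (abs_sub_shift_le ha (hm.trans hmk)).trans ?_
    gcongr
  refine (Finset.sum_le_card_nsmul _ _ _ h).trans_eq ?_
  rw [Nat.card_Icc, show 2 * m - 1 + 1 - m = m by omega, nsmul_eq_mul]
  field_simp

theorem one_div_cube_le_div {r : ℕ} {a : ℕ → ℝ}
    (ha : ∀ n : ℕ, a n = (2 + (if r ∣ n then (-1 : ℝ) else 1)) / (n : ℝ) ^ 2) (k : ℕ) :
    1 / (k : ℝ) ^ 3 ≤ a k / k := by
  rw [ha, div_div, ← pow_succ]
  gcongr
  split_ifs <;> norm_num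

theorem le_sum_div {r : ℕ} {a : ℕ → ℝ}
    (ha : ∀ n : ℕ, a n = (2 + (if r ∣ n then (-1 : ℝ) else 1)) / (n : ℝ) ^ 2)
    {c : ℝ} (hc : 1 < c) {m : ℕ} (hm : 1 ≤ m) :
    (c - 1) / (c ^ 3 * (m : ℝ) ^ 2) ≤
      ∑ k ∈ Finset.Icc (max 1 ⌊(m : ℝ) / c⌋₊) ⌊c * (m : ℝ)⌋₊, a k / (k : ℝ) := by
  have hm0 : (0 : ℝ) < m := by exact_mod_cast hm
  have hc0 : 0 < c := by linarith
  have hterm : ∀ k ∈ Finset.Icc m ⌊c * (m : ℝ)⌋₊, 1 / (c * (m : ℝ)) ^ 3 ≤ a k / k := by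
    intro k hk
    obtain ⟨hmk, hkc⟩ := Finset.mem_Icc.1 hk
    have hk0 : (0 : ℝ) < k := by exact_mod_cast hm.trans hmk
    have hkc' : (k : ℝ) ≤ c * m := (Nat.le_floor_iff (by positivity)).1 hkc
    refine le_trans ?_ (one_div_cube_le_div ha k)
    gcongr
  have hstart : max 1 ⌊(m : ℝ) / c⌋₊ ≤ m :=
    max_le hm (Nat.floor_le_of_le (div_le_self hm0.le hc.le))
  have hcard : (c - 1) * m ≤ ((Finset.Icc m ⌊c * (m : ℝ)⌋₊).card : ℝ) := by
    have h1 : m ≤ ⌊c * (m : ℝ)⌋₊ := Nat.le_floor (by nlinarith)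
    have h2 := Nat.lt_floor_add_one (c * (m : ℝ))
    rw [Nat.card_Icc, Nat.cast_sub (by omega)]
    push_cast
    linarith
  calc (c - 1) / (c ^ 3 * (m : ℝ) ^ 2) = ((c - 1) * m) * (1 / (c * (m : ℝ)) ^ 3) := by
        field_simp
    _ ≤ (Finset.Icc m ⌊c * (m : ℝ)⌋₊).card * (1 / (c * (m : ℝ)) ^ 3) := by gcongr
    _ = (Finset.Icc m ⌊c * (m : ℝ)⌋₊).card • (1 / (c * (m : ℝ)) ^ 3) := by rw [nsmul_eq_mul]
    _ ≤ ∑ k ∈ Finset.Icc m ⌊c * (m : ℝ)⌋₊, a k / (k : ℝ) :=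
        Finset.card_nsmul_le_sum _ _ _ hterm
    _ ≤ _ := Finset.sum_le_sum_of_subset_of_nonneg (Finset.Icc_subset_Icc_left hstart)
        fun k _ _ => le_trans (by positivity) (one_div_cube_le_div ha k)

theorem example_sequence_in_gm_star
    (r : ℕ) (hr : 1 ≤ r) (a : ℕ → ℝ)
    (ha : ∀ n : ℕ, a n = (2 + (if r ∣ n then (-1 : ℝ) else 1)) / (n : ℝ) ^ 2) :
    ∀ c : ℝ, 1 < c → ∃ K : ℝ, 0 < K ∧ ∀ m : ℕ, 1 ≤ m →
      (∑ k ∈ Finset.Icc m (2 * m - 1), |a k - a (k + r)|) ≤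
        K * ∑ k ∈ Finset.Icc (max 1 ⌊(m : ℝ) / c⌋₊) ⌊c * (m : ℝ)⌋₊, a k / (k : ℝ) := by
  intro c hc
  have hr0 : (0 : ℝ) < r := by exact_mod_cast hr
  have hc1 : 0 < c - 1 := sub_pos.2 hc
  have hc0 : 0 < c := by linarith
  have hK : 0 < 6 * r * c ^ 3 / (c - 1) := by positivity
  refine ⟨6 * r * c ^ 3 / (c - 1), hK, fun m hm => ?_⟩
  have hm0 : (0 : ℝ) < m := by exact_mod_cast hm
  calc _ ≤ 6 * r / (m : ℝ) ^ 2 := sum_abs_sub_shift_le ha hm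
    _ = 6 * r * c ^ 3 / (c - 1) * ((c - 1) / (c ^ 3 * (m : ℝ) ^ 2)) := by
        field_simp
    _ ≤ _ := mul_le_mul_of_nonneg_left (le_sum_div ha hc hm) hK.le
end

section
/- Let r, s ≥ 1 be natural numbers with r ∤ s, and define the sequence a_n = (2 + α_n)/n², where α_n = −1 if r ∣ n and α_n = 1 if r ∤ n. Then (a_n) does not belong to GM(β*, s): for no constant K > 0 and real c > 1 does the inequality ∑_{k=n}^{2n-1} |a_k − a_{k+s}| ≤ K·( ∑_{k=n}^{n+s-1} a_k + ∑_{k=max(1,⌊n/c⌋)}^{⌊cn⌋} a_k/k ) hold for all n ≥ 1. -/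
open Finset

/-- Along the multiples of `r`, the jumps of the sequence over a block `[n, 2n - 1]` with
`n = r * N` add up to at least a constant times `1 / n`. -/
lemma le_sum_abs_sub_shift {r s N : ℕ} (hr : 1 ≤ r) (hns : ¬ r ∣ s) {a : ℕ → ℝ}
    (ha : ∀ n : ℕ, a n = (2 + (if r ∣ n then (-1 : ℝ) else 1)) / (n : ℝ) ^ 2)
    (hN : 1 ≤ N) (hsN : 2 * s ≤ N) :
    (N : ℝ) * (1 / (12 * ((r * N : ℕ) : ℝ) ^ 2)) ≤
      ∑ k ∈ Finset.Icc (r * N) (2 * (r * N) - 1), |a k - a (k + s)| := by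
  have hinj : Set.InjOn (fun j : ℕ => r * (N + j)) (Finset.range N : Set ℕ) := by
    intro i _ j _ hij
    have := Nat.eq_of_mul_eq_mul_left hr hij
    omega
  have hsub : (Finset.range N).image (fun j : ℕ => r * (N + j)) ⊆
      Finset.Icc (r * N) (2 * (r * N) - 1) := by
    intro k hk
    obtain ⟨j, hj, rfl⟩ := Finset.mem_image.1 hk
    have hj := Finset.mem_range.1 hj
    have h1 : r * (j + 1) ≤ r * N := Nat.mul_le_mul_left r hj
    rw [Finset.mem_Icc, Nat.mul_add]
    rw [Nat.mul_add] at h1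
    omega
  refine le_trans ?_ (Finset.sum_le_sum_of_subset_of_nonneg hsub fun _ _ _ => abs_nonneg _)
  rw [Finset.sum_image hinj]
  have hterm : ∀ j ∈ Finset.range N, 1 / (12 * ((r * N : ℕ) : ℝ) ^ 2) ≤
      |a (r * (N + j)) - a (r * (N + j) + s)| := by
    intro j hj
    have hj := Finset.mem_range.1 hj
    have hrN : N ≤ r * (N + j) := by nlinarith
    have hle : r * (N + j) ≤ 2 * (r * N) := by nlinarith
    have hnd : ¬ r ∣ r * (N + j) + s := by
      rwa [Nat.dvd_add_right (dvd_mul_right r _)]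
    rw [ha, ha, if_pos (dvd_mul_right r _), if_neg hnd]
    generalize r * (N + j) = k at *
    have hk : (1 : ℝ) ≤ k := by exact_mod_cast hN.trans hrN
    have hsk : 2 * (s : ℝ) ≤ k := by exact_mod_cast hsN.trans hrN
    have hkn : (k : ℝ) ≤ 2 * ((r * N : ℕ) : ℝ) := by exact_mod_cast hle
    have h1 : 4 / (3 * (k : ℝ) ^ 2) ≤ (2 + 1) / ((k + s : ℕ) : ℝ) ^ 2 := by
      push_cast
      rw [div_le_div_iff₀ (by positivity) (by positivity)]
      nlinarith [pow_le_pow_left₀ (by positivity)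
        (show (k : ℝ) + s ≤ 3 / 2 * k by linarith) 2]
    have h2 : 1 / (12 * ((r * N : ℕ) : ℝ) ^ 2) ≤ 1 / (3 * (k : ℝ) ^ 2) := by
      apply one_div_le_one_div_of_le (by positivity)
      nlinarith [pow_le_pow_left₀ (by positivity) hkn 2]
    have h3 : 4 / (3 * (k : ℝ) ^ 2) - (2 + -1) / (k : ℝ) ^ 2 = 1 / (3 * (k : ℝ) ^ 2) := by
      field_simp
      norm_num
    rw [abs_sub_comm]
    exact le_trans (by linarith) (le_abs_self _)
  simpa using Finset.card_nsmul_le_sum _ _ _ hterm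

/-- If `a k ≤ 3 / k ^ 2`, then a sum of `s` terms starting at `n` is at most `3 s / n ^ 2`. -/
lemma sum_Icc_shift_le {a : ℕ → ℝ} (hle : ∀ k : ℕ, a k ≤ 3 / (k : ℝ) ^ 2) {n : ℕ} (hn : 1 ≤ n)
    (s : ℕ) :
    ∑ k ∈ Finset.Icc n (n + s - 1), a k ≤ (s : ℝ) * (3 / (n : ℝ) ^ 2) := by
  have hn0 : (0 : ℝ) < n := by exact_mod_cast hn
  have h := Finset.sum_le_card_nsmul (Finset.Icc n (n + s - 1)) a (3 / (n : ℝ) ^ 2) (by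
    intro k hk
    have hk : (n : ℝ) ≤ k := by exact_mod_cast (Finset.mem_Icc.1 hk).1
    refine (hle k).trans ?_
    gcongr)
  have hcard : n + s - 1 + 1 - n = s := by omega
  simpa [hcard] using h

/-- If `a k ≤ 3 / k ^ 2`, then the weighted average of `a` over `[n / c, c n]` is
`O(1 / n ^ 2)`. -/
lemma sum_Icc_floor_div_le {a : ℕ → ℝ} (hle : ∀ k : ℕ, a k ≤ 3 / (k : ℝ) ^ 2) {n : ℕ}
    (hn : 1 ≤ n) {c : ℝ} (hc : 1 < c) :
    ∑ k ∈ Finset.Icc (max 1 ⌊(n : ℝ) / c⌋₊) ⌊c * (n : ℝ)⌋₊, a k / (k : ℝ) ≤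
      24 * c ^ 4 / (n : ℝ) ^ 2 := by
  have hn0 : (0 : ℝ) < n := by exact_mod_cast hn
  have hc0 : 0 < c := by linarith
  have hsum := Finset.sum_le_card_nsmul (Finset.Icc (max 1 ⌊(n : ℝ) / c⌋₊) ⌊c * (n : ℝ)⌋₊)
    (fun k => a k / (k : ℝ)) (3 / ((n : ℝ) / (2 * c)) ^ 3) (by
      intro k hk
      have hk := (Finset.mem_Icc.1 hk).1
      have hk1 : (1 : ℝ) ≤ k := by exact_mod_cast (le_max_left _ _).trans hk
      have hkf : (⌊(n : ℝ) / c⌋₊ : ℝ) ≤ k := by exact_mod_cast (le_max_right _ _).trans hk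
      have hlt := Nat.lt_floor_add_one ((n : ℝ) / c)
      have hnk : (n : ℝ) / (2 * c) ≤ k := by
        have : (n : ℝ) / (2 * c) = (n : ℝ) / c / 2 := by
          field_simp
        linarith
      have hstep : a k / (k : ℝ) ≤ 3 / (k : ℝ) ^ 2 / k := by
        gcongr
        exact hle k
      refine hstep.trans ?_
      rw [div_div, ← pow_succ]
      gcongr)
  have hcard : ((Finset.Icc (max 1 ⌊(n : ℝ) / c⌋₊) ⌊c * (n : ℝ)⌋₊).card : ℝ) ≤ c * n := by
    refine le_trans ?_ (Nat.floor_le (by positivity : 0 ≤ c * (n : ℝ)))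
    rw [Nat.card_Icc]
    have := le_max_left 1 ⌊(n : ℝ) / c⌋₊
    exact_mod_cast (by omega)
  rw [nsmul_eq_mul] at hsum
  refine hsum.trans ((mul_le_mul_of_nonneg_right hcard (by positivity)).trans_eq ?_)
  field_simp
  norm_num


theorem example_sequence_not_in_gm_star
    (r s : ℕ) (hr : 1 ≤ r) (hs : 1 ≤ s) (hns : ¬ r ∣ s) (a : ℕ → ℝ)
    (ha : ∀ n : ℕ, a n = (2 + (if r ∣ n then (-1 : ℝ) else 1)) / (n : ℝ) ^ 2) :
    ¬ ∃ K : ℝ, 0 < K ∧ ∃ c : ℝ, 1 < c ∧ ∀ n : ℕ, 1 ≤ n →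
      (∑ k ∈ Finset.Icc n (2 * n - 1), |a k - a (k + s)|) ≤
        K * ((∑ k ∈ Finset.Icc n (n + s - 1), a k) +
          ∑ k ∈ Finset.Icc (max 1 ⌊(n : ℝ) / c⌋₊) ⌊c * (n : ℝ)⌋₊, a k / (k : ℝ)) := by
  rintro ⟨K, hK, c, hc, h⟩
  have hle : ∀ k : ℕ, a k ≤ 3 / (k : ℝ) ^ 2 := by
    intro k
    rw [ha]
    gcongr
    split_ifs <;> norm_num
  obtain ⟨M, hM⟩ := exists_nat_gt (12 * K * (3 * s + 24 * c ^ 4))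
  let N := M + 2 * s
  have hN : 1 ≤ N := by omega
  have hMN : (M : ℝ) ≤ N := by exact_mod_cast Nat.le_add_right M (2 * s)
  have hn : 1 ≤ r * N := Nat.mul_pos hr hN
  have hn0 : (0 : ℝ) < ((r * N : ℕ) : ℝ) := by exact_mod_cast hn
  have hlower := le_sum_abs_sub_shift hr hns ha hN (Nat.le_add_left _ _)
  have hupper := mul_le_mul_of_nonneg_left
    (add_le_add (sum_Icc_shift_le hle hn s) (sum_Icc_floor_div_le hle hn hc)) hK.le
  have hcmp := hlower.trans ((h (r * N) hn).trans hupper)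
  generalize ((r * N : ℕ) : ℝ) = x at hcmp hn0
  have hfin : (N : ℝ) ≤ 12 * K * (3 * s + 24 * c ^ 4) := by
    have := mul_le_mul_of_nonneg_right hcmp (by positivity : 0 ≤ 12 * x ^ 2)
    field_simp at this
    linarith
  linarith
end

section
/- Let r ≥ 1 be a natural number and let (b_n)_{n≥1} be a nonnegative real sequence belonging to GM(β*, r). If the series ∑_{n=1}^∞ b_n sin(nx) converges uniformly in x on ℝ, then n·b_n → 0 as n → ∞. -/
open Finset Filter

/-- The class `GM(β*, r)` for real sequences: `b` belongs to it if there exist `K > 0` and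
`c > 1` such that for every `m ≥ 1`,
`∑_{n=m}^{2m-1} |b_n − b_{n+r}| ≤ K (∑_{k=m}^{m+r-1} |b_k| + ∑_{k=max(1,⌊m/c⌋)}^{⌊cm⌋} |b_k|/k)`. -/
def GMstar (b : ℕ → ℝ) (r : ℕ) : Prop :=
  ∃ K : ℝ, 0 < K ∧ ∃ c : ℝ, 1 < c ∧ ∀ m : ℕ, 1 ≤ m →
    (∑ n ∈ Finset.Icc m (2 * m - 1), |b n - b (n + r)|) ≤
      K * ((∑ k ∈ Finset.Icc m (m + r - 1), |b k|) +
        ∑ k ∈ Finset.Icc (max 1 ⌊(m : ℝ) / c⌋₊) ⌊c * (m : ℝ)⌋₊, |b k| / (k : ℝ))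

/-- The partial sums of the sine series `∑ b_n sin (n x)`. -/
noncomputable def sinePartialSum (b : ℕ → ℝ) (N : ℕ) (x : ℝ) : ℝ :=
  ∑ n ∈ Finset.Icc 1 N, b n * Real.sin (n * x)

/-- For nonnegative coefficients, uniform convergence of the sine series makes the tails of
`∑ k b_k` sublinear. -/
lemma exists_sum_Ioc_mul_le_of_tendstoUniformly {b : ℕ → ℝ} (hb : ∀ n, 0 ≤ b n)
    {f : ℝ → ℝ} (hf : TendstoUniformly (fun N x => sinePartialSum b N x) f atTop)
    {ε : ℝ} (hε : 0 < ε) :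
    ∃ N : ℕ, ∀ M : ℕ, N ≤ M → ∑ k ∈ Finset.Ioc N M, (k : ℝ) * b k ≤ ε * M := by
  rw [Metric.tendstoUniformly_iff] at hf
  obtain ⟨N, hN⟩ := eventually_atTop.1 (hf (ε / 2) (half_pos hε))
  refine ⟨N, fun M hM => ?_⟩
  rcases Nat.eq_zero_or_pos M with rfl | hM0
  · simp
  have hMr : (0 : ℝ) < M := by exact_mod_cast hM0
  set x : ℝ := Real.pi / (2 * M) with hx
  have hpi := Real.pi_pos
  have hsplit : sinePartialSum b M x =
      sinePartialSum b N x + ∑ k ∈ Finset.Ioc N M, b k * Real.sin (k * x) := by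
    have h := Finset.sum_Ioc_consecutive (fun k : ℕ => b k * Real.sin (k * x)) (Nat.zero_le N) hM
    exact h.symm
  have hlt : ∑ k ∈ Finset.Ioc N M, b k * Real.sin (k * x) < ε := by
    have h1 := hN N le_rfl x
    have h2 := hN M hM x
    rw [Real.dist_eq, abs_lt] at h1 h2
    linarith [h1.1, h1.2, h2.1, h2.2]
  have hle : ∑ k ∈ Finset.Ioc N M, (k : ℝ) * b k / M ≤
      ∑ k ∈ Finset.Ioc N M, b k * Real.sin (k * x) := by
    refine Finset.sum_le_sum fun k hk => ?_
    have hkM : (k : ℝ) ≤ M := by exact_mod_cast (Finset.mem_Ioc.1 hk).2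
    have hkx : (k : ℝ) * x ≤ Real.pi / 2 := by
      calc (k : ℝ) * x ≤ M * x := by gcongr
        _ = Real.pi / 2 := by rw [hx]; field_simp
    have hsin := Real.mul_le_sin (by positivity : (0 : ℝ) ≤ k * x) hkx
    calc (k : ℝ) * b k / M = b k * (2 / Real.pi * (k * x)) := by rw [hx]; field_simp
      _ ≤ b k * Real.sin (k * x) := mul_le_mul_of_nonneg_left hsin (hb k)
  rw [← Finset.sum_div] at hle
  exact (div_le_iff₀ hMr).1 (hle.trans hlt.le)

/-- For nonnegative coefficients, uniform convergence of the sine series makes the sums of `b_k`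
over the blocks `n / D ≤ k ≤ D n` tend to zero. -/
lemma eventually_sum_block_le_of_tendstoUniformly {b : ℕ → ℝ} (hb : ∀ n, 0 ≤ b n)
    {f : ℝ → ℝ} (hf : TendstoUniformly (fun N x => sinePartialSum b N x) f atTop)
    {D : ℕ} (hD : 0 < D) {ε : ℝ} (hε : 0 < ε) :
    ∀ᶠ n : ℕ in atTop, ∑ k ∈ Finset.Icc 1 (D * n) with n ≤ D * k, b k ≤ ε := by
  have hDr : (0 : ℝ) < D := by exact_mod_cast hD
  obtain ⟨N, hN⟩ := exists_sum_Ioc_mul_le_of_tendstoUniformly hb hf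
    (by positivity : 0 < ε / (D : ℝ) ^ 2)
  filter_upwards [eventually_gt_atTop (D * N)] with n hn
  have hn0 : 0 < n := by omega
  have hnr : (0 : ℝ) < n := by exact_mod_cast hn0
  have hNn : N ≤ D * n := by nlinarith
  calc ∑ k ∈ Finset.Icc 1 (D * n) with n ≤ D * k, b k
      ≤ ∑ k ∈ Finset.Icc 1 (D * n) with n ≤ D * k, D / n * (k * b k) := by
        refine Finset.sum_le_sum fun k hk => ?_
        have hk : (n : ℝ) ≤ D * k := by exact_mod_cast (Finset.mem_filter.1 hk).2
        have h : 1 ≤ (D : ℝ) * k / n := (one_le_div hnr).2 hk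
        calc b k = 1 * b k := (one_mul _).symm
          _ ≤ D * k / n * b k := mul_le_mul_of_nonneg_right h (hb k)
          _ = D / n * (k * b k) := by ring
    _ ≤ ∑ k ∈ Finset.Ioc N (D * n), D / n * (k * b k) := by
        refine Finset.sum_le_sum_of_subset_of_nonneg (fun k hk => ?_) fun k _ _ => ?_
        · simp only [Finset.mem_filter, Finset.mem_Icc] at hk
          exact Finset.mem_Ioc.2 ⟨lt_of_mul_lt_mul_left (hn.trans_le hk.2) (Nat.zero_le D), hk.1.2⟩
        · have := hb k
          positivity
    _ = D / n * ∑ k ∈ Finset.Ioc N (D * n), k * b k := by rw [Finset.mul_sum]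
    _ ≤ D / n * (ε / (D : ℝ) ^ 2 * (D * n : ℕ)) := by
        gcongr
        exact hN _ hNn
    _ = ε := by push_cast; field_simp

/-- A term of a nonnegative sequence is controlled by an earlier window of length `r` and the
`r`-step variation in between. -/
lemma le_sum_window_add_sum_abs_sub {b : ℕ → ℝ} (hb : ∀ n, 0 ≤ b n) {r : ℕ} (hr : 1 ≤ r)
    {m : ℕ} (n : ℕ) (hmn : m ≤ n) :
    b n ≤ ∑ k ∈ Finset.Icc m (m + r - 1), b k + ∑ k ∈ Finset.Ico m n, |b k - b (k + r)| := by
  induction n using Nat.strong_induction_on with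
  | _ n ih =>
    by_cases hn : n ≤ m + r - 1
    · have h1 := Finset.single_le_sum (fun k _ => hb k) (Finset.mem_Icc.2 ⟨hmn, hn⟩)
      have h2 : 0 ≤ ∑ k ∈ Finset.Ico m n, |b k - b (k + r)| :=
        Finset.sum_nonneg fun _ _ => abs_nonneg _
      linarith
    · obtain ⟨l, rfl⟩ : ∃ l, n = l + r := ⟨n - r, by omega⟩
      have hml : m ≤ l := by omega
      have h1 := ih l (by omega) hml
      have h2 := Finset.sum_Ico_succ_top hml fun k => |b k - b (k + r)|
      have h3 : ∑ k ∈ Finset.Ico m (l + 1), |b k - b (k + r)| ≤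
          ∑ k ∈ Finset.Ico m (l + r), |b k - b (k + r)| :=
        Finset.sum_le_sum_of_subset_of_nonneg (Finset.Ico_subset_Ico_right (by omega))
          fun _ _ _ => abs_nonneg _
      linarith [neg_abs_le (b l - b (l + r))]

/-- Every nonnegative sequence in `GM(β*, r)` has `n b_n` bounded by a multiple of the sum of `b_k`
over a block `n / D ≤ k ≤ D n`. -/
lemma GMstar.exists_mul_le_sum_block {b : ℕ → ℝ} (hb : ∀ n, 0 ≤ b n) {r : ℕ} (hr : 1 ≤ r)
    (hgm : GMstar b r) :
    ∃ D : ℕ, 0 < D ∧ ∃ L : ℝ, 0 < L ∧ ∀ n : ℕ, r ≤ n →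
      n * b n ≤ L * ∑ k ∈ Finset.Icc 1 (D * n) with n ≤ D * k, b k := by
  obtain ⟨K, hK, c, hc, h⟩ := hgm
  obtain ⟨C, hcC⟩ := exists_nat_ge c
  have hC1 : (1 : ℝ) < C := hc.trans_le hcC
  have hC : 1 < C := by exact_mod_cast hC1
  refine ⟨4 * C, by omega, 2 * ((1 + K) * r + K * (4 * C)), by positivity, fun n hn => ?_⟩
  set U := ∑ k ∈ Finset.Icc 1 (4 * C * n) with n ≤ 4 * C * k, b k with hU
  have hU0 : 0 ≤ U := Finset.sum_nonneg fun k _ => hb k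
  have hn0 : 0 < n := by omega
  have hnr : (0 : ℝ) < n := by exact_mod_cast hn0
  set s := Finset.Icc ((n + 1) / 2) n with hs
  have hterm : ∀ m ∈ s, b n ≤
      (1 + K) * ∑ k ∈ Finset.Icc m (m + r - 1), b k + K * (4 * C / n * U) := by
    intro m hm
    rw [hs, Finset.mem_Icc] at hm
    have hm1 : 1 ≤ m := by omega
    have hnm : n ≤ 2 * m := by omega
    have hnmr : (n : ℝ) ≤ 2 * m := by exact_mod_cast hnm
    have hmnr : (m : ℝ) ≤ n := by exact_mod_cast hm.2
    have hvar : ∑ k ∈ Finset.Ico m n, |b k - b (k + r)| ≤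
        ∑ k ∈ Finset.Icc m (2 * m - 1), |b k - b (k + r)| :=
      Finset.sum_le_sum_of_subset_of_nonneg
        (fun k hk => by rw [Finset.mem_Ico] at hk; rw [Finset.mem_Icc]; omega)
        fun _ _ _ => abs_nonneg _
    have hblock : ∑ k ∈ Finset.Icc (max 1 ⌊(m : ℝ) / c⌋₊) ⌊c * (m : ℝ)⌋₊, b k / (k : ℝ) ≤
        4 * C / n * U := by
      have hmem : ∀ k ∈ Finset.Icc (max 1 ⌊(m : ℝ) / c⌋₊) ⌊c * (m : ℝ)⌋₊,
          1 ≤ k ∧ k ≤ 4 * C * n ∧ n ≤ 4 * C * k := by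
        intro k hk
        rw [Finset.mem_Icc, max_le_iff] at hk
        obtain ⟨⟨hk1, hk2⟩, hk3⟩ := hk
        have hk1r : (1 : ℝ) ≤ k := by exact_mod_cast hk1
        refine ⟨hk1, ?_, ?_⟩
        · have h1 : (k : ℝ) ≤ c * m := (Nat.le_floor_iff (by positivity)).1 hk3
          have h2 : (k : ℝ) ≤ C * n := h1.trans (by gcongr)
          have h3 : k ≤ C * n := by exact_mod_cast h2
          nlinarith
        · have h1 : (m : ℝ) / c < k + 1 :=
            (Nat.lt_floor_add_one _).trans_le (by exact_mod_cast Nat.succ_le_succ hk2)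
          rw [div_lt_iff₀ (by linarith)] at h1
          have h2 : ((k : ℝ) + 1) * c ≤ (2 * k) * C := by gcongr; linarith
          have h3 : (n : ℝ) ≤ 4 * C * k := by linarith
          exact_mod_cast h3
      rw [hU, Finset.mul_sum]
      calc ∑ k ∈ Finset.Icc (max 1 ⌊(m : ℝ) / c⌋₊) ⌊c * (m : ℝ)⌋₊, b k / (k : ℝ)
          ≤ ∑ k ∈ Finset.Icc (max 1 ⌊(m : ℝ) / c⌋₊) ⌊c * (m : ℝ)⌋₊, 4 * C / n * b k := by
            refine Finset.sum_le_sum fun k hk => ?_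
            obtain ⟨hk1, -, hk2⟩ := hmem k hk
            have hk0 : (0 : ℝ) < k := by exact_mod_cast hk1
            have hk2r : (n : ℝ) ≤ 4 * C * k := by exact_mod_cast hk2
            have hinv : 1 / (k : ℝ) ≤ 4 * C / n := by
              rw [div_le_div_iff₀ hk0 hnr]
              linarith
            calc b k / (k : ℝ) = 1 / k * b k := by ring
              _ ≤ 4 * C / n * b k := mul_le_mul_of_nonneg_right hinv (hb k)
        _ ≤ _ := by
            refine Finset.sum_le_sum_of_subset_of_nonneg (fun k hk => ?_) fun k _ _ => ?_
            · obtain ⟨hk1, hk2, hk3⟩ := hmem k hk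
              exact Finset.mem_filter.2 ⟨Finset.mem_Icc.2 ⟨hk1, hk2⟩, hk3⟩
            · have := hb k
              positivity
    have hgm := h m hm1
    simp only [abs_of_nonneg (hb _)] at hgm
    have hKblock := mul_le_mul_of_nonneg_left hblock hK.le
    linarith [le_sum_window_add_sum_abs_sub hb hr n hm.2]
  have hwindows : ∑ m ∈ s, ∑ k ∈ Finset.Icc m (m + r - 1), b k ≤ r * U := by
    have hshift : ∀ m, ∑ k ∈ Finset.Icc m (m + r - 1), b k = ∑ i ∈ Finset.range r, b (m + i) := by
      intro m
      have hI : Finset.Icc m (m + r - 1) = Finset.Ico m (m + r) := by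
        ext k
        simp only [Finset.mem_Icc, Finset.mem_Ico]
        omega
      rw [hI, Finset.sum_Ico_eq_sum_range, Nat.add_sub_cancel_left]
    simp only [hshift]
    rw [Finset.sum_comm]
    refine (Finset.sum_le_card_nsmul _ _ U fun i hi => ?_).trans_eq (by simp)
    rw [Finset.mem_range] at hi
    rw [← Finset.sum_image (f := b) (g := fun m => m + i) (fun x _ y _ hxy => by simpa using hxy)]
    refine Finset.sum_le_sum_of_subset_of_nonneg (fun k hk => ?_) fun k _ _ => hb k
    obtain ⟨m, hm, rfl⟩ := Finset.mem_image.1 hk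
    rw [hs, Finset.mem_Icc] at hm
    refine Finset.mem_filter.2 ⟨Finset.mem_Icc.2 ⟨by omega, ?_⟩, ?_⟩
    · nlinarith
    · have : n ≤ 2 * (m + i) := by omega
      nlinarith
  have hcard : s.card = n + 1 - (n + 1) / 2 := Nat.card_Icc _ _
  have hcard_le : (s.card : ℝ) ≤ n := by
    rw [hcard]
    exact_mod_cast (by omega : n + 1 - (n + 1) / 2 ≤ n)
  have hcard_ge : (n : ℝ) ≤ 2 * s.card := by
    rw [hcard]
    exact_mod_cast (by omega : n ≤ 2 * (n + 1 - (n + 1) / 2))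
  have hsum := Finset.sum_le_sum hterm
  rw [Finset.sum_add_distrib, ← Finset.mul_sum, Finset.sum_const, Finset.sum_const,
    nsmul_eq_mul, nsmul_eq_mul] at hsum
  have hrest : (s.card : ℝ) * (K * (4 * C / n * U)) ≤ K * (4 * C) * U := by
    calc (s.card : ℝ) * (K * (4 * C / n * U)) ≤ n * (K * (4 * C / n * U)) := by gcongr
      _ = K * (4 * C) * U := by field_simp
  have hwin := mul_le_mul_of_nonneg_left hwindows (by linarith : 0 ≤ 1 + K)
  have hleft := mul_le_mul_of_nonneg_right hcard_ge (hb n)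
  linarith

theorem necessity_of_nbn_to_zero
    (r : ℕ) (hr : 1 ≤ r) (b : ℕ → ℝ) (hb : ∀ n, 0 ≤ b n) (hgm : GMstar b r)
    (hconv : ∃ f : ℝ → ℝ, TendstoUniformly (fun N x => sinePartialSum b N x) f atTop) :
    Tendsto (fun n : ℕ => (n : ℝ) * b n) atTop (nhds 0) := by
  obtain ⟨f, hf⟩ := hconv
  obtain ⟨D, hD, L, hL, hbound⟩ := hgm.exists_mul_le_sum_block hb hr
  rw [Metric.tendsto_nhds]
  intro ε hε
  filter_upwards [eventually_ge_atTop r, eventually_sum_block_le_of_tendstoUniformly hb hf hD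
    (by positivity : 0 < ε / (2 * L))] with n hn hblock
  have hnonneg : 0 ≤ (n : ℝ) * b n := mul_nonneg n.cast_nonneg (hb n)
  rw [Real.dist_eq, sub_zero, abs_of_nonneg hnonneg]
  calc (n : ℝ) * b n ≤ L * (ε / (2 * L)) :=
        (hbound n hn).trans (mul_le_mul_of_nonneg_left hblock hL.le)
    _ = ε / 2 := by field_simp
    _ < ε := half_lt_self hε
end

section
/- Let r ≥ 1 be a natural number and let (b_n)_{n≥1} be a nonnegative real sequence belonging to GM(β*, r). Then (b_n) is weak monotone: there exist a constant K > 0 and a real number c₁ > 1 such that n·b_n ≤ K·∑_{k=max(1,⌊n/c₁⌋)}^{⌊c₁ n⌋} b_k for all n ≥ 1. -/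
open Finset Filter

/-- Telescoping along an arithmetic progression of difference `r`: `b n` is controlled by the
first `r` terms from `m` on, plus the `r`-step variation between `m` and `n`. -/
theorem le_sum_Ico_add_sum_abs_sub (b : ℕ → ℝ) (hb : ∀ n, 0 ≤ b n) {r : ℕ} (hr : 1 ≤ r)
    {m n : ℕ} (hmn : m ≤ n) :
    b n ≤ (∑ k ∈ Finset.Ico m (m + r), b k) +
      ∑ k ∈ Finset.Ico m (n + 1 - r), |b k - b (k + r)| := by
  induction n using Nat.strong_induction_on with
  | _ n ih =>
    rcases lt_or_ge n (m + r) with h | h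
    · have h₁ : b n ≤ ∑ k ∈ Finset.Ico m (m + r), b k :=
        Finset.single_le_sum (fun i _ => hb i) (Finset.mem_Ico.2 ⟨hmn, h⟩)
      have h₂ : 0 ≤ ∑ k ∈ Finset.Ico m (n + 1 - r), |b k - b (k + r)| :=
        Finset.sum_nonneg fun _ _ => abs_nonneg _
      linarith
    · obtain ⟨k, rfl⟩ : ∃ k, n = k + r := ⟨n - r, by omega⟩
      have hk := ih k (by omega) (by omega)
      have hs : ∑ j ∈ Finset.Ico m (k + 1 - r), |b j - b (j + r)| ≤
          ∑ j ∈ Finset.Ico m k, |b j - b (j + r)| :=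
        Finset.sum_le_sum_of_subset_of_nonneg
          (Finset.Ico_subset_Ico_right (by omega)) fun _ _ _ => abs_nonneg _
      have he : k + r + 1 - r = k + 1 := by omega
      rw [he, Finset.sum_Ico_succ_top (by omega)]
      have := neg_abs_le (b k - b (k + r))
      linarith

theorem gm_star_implies_weak_monotone
    (r : ℕ) (hr : 1 ≤ r) (b : ℕ → ℝ) (hb : ∀ n, 0 ≤ b n) (hgm : GMstar b r) :
    ∃ K : ℝ, 0 < K ∧ ∃ c₁ : ℝ, 1 < c₁ ∧ ∀ n : ℕ, 1 ≤ n →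
      (n : ℝ) * b n ≤ K * ∑ k ∈ Finset.Icc (max 1 ⌊(n : ℝ) / c₁⌋₊) ⌊c₁ * (n : ℝ)⌋₊, b k := by
  obtain ⟨K, hK, c, hc, H⟩ := hgm
  have hr' : (1 : ℝ) ≤ r := by exact_mod_cast hr
  have hc0 : 0 < c := by linarith
  refine ⟨2 * ((1 + K) * r + 8 * c * K), by positivity, 4 * c + r, by linarith, fun n hn => ?_⟩
  have hn' : (1 : ℝ) ≤ n := by exact_mod_cast hn
  have hn0 : (0 : ℝ) < n := by linarith
  set I := Finset.Icc (max 1 ⌊(n : ℝ) / (4 * c + r)⌋₊) ⌊(4 * c + r) * (n : ℝ)⌋₊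
  set W := ∑ k ∈ I, b k with hW
  have hW0 : 0 ≤ W := Finset.sum_nonneg fun i _ => hb i
  have mem_window : ∀ k : ℕ, 1 ≤ k → (n : ℝ) ≤ 4 * c * k → (k : ℝ) ≤ (4 * c + r) * n →
      k ∈ I := by
    intro k hk h₁ h₂
    refine Finset.mem_Icc.2 ⟨max_le hk ?_, Nat.le_floor h₂⟩
    refine Nat.floor_le_of_le ?_
    rw [div_le_iff₀ (by positivity)]
    have : 0 ≤ (r : ℝ) * k := by positivity
    nlinarith
  have pointwise : ∀ m ∈ Finset.Icc (n - n / 2) n,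
      b n ≤ (1 + K) * (∑ i ∈ Finset.range r, b (m + i)) + K * (4 * c / n * W) := by
    intro m hm
    obtain ⟨hm₁, hm₂⟩ := Finset.mem_Icc.1 hm
    have hm0 : 1 ≤ m := by omega
    have hnm : (n : ℝ) ≤ 2 * m := by exact_mod_cast (by omega : n ≤ 2 * m)
    have hmn : (m : ℝ) ≤ n := by exact_mod_cast hm₂
    have hT := le_sum_Ico_add_sum_abs_sub b hb hr hm₂
    have hV : ∑ k ∈ Finset.Ico m (n + 1 - r), |b k - b (k + r)| ≤
        ∑ k ∈ Finset.Icc m (2 * m - 1), |b k - b (k + r)| := by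
      refine Finset.sum_le_sum_of_subset_of_nonneg (fun k hk => ?_) fun _ _ _ => abs_nonneg _
      rw [Finset.mem_Ico] at hk
      rw [Finset.mem_Icc]
      omega
    have hfirst : ∑ k ∈ Finset.Icc m (m + r - 1), |b k| = ∑ i ∈ Finset.range r, b (m + i) := by
      have : Finset.Icc m (m + r - 1) = Finset.Ico m (m + r) := by
        ext k
        rw [Finset.mem_Icc, Finset.mem_Ico]
        omega
      rw [this, Finset.sum_Ico_eq_sum_range, Nat.add_sub_cancel_left]
      exact Finset.sum_congr rfl fun i _ => abs_of_nonneg (hb _)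
    have hsecond : ∑ k ∈ Finset.Icc (max 1 ⌊(m : ℝ) / c⌋₊) ⌊c * (m : ℝ)⌋₊, |b k| / (k : ℝ) ≤
        4 * c / n * W := by
      have bounds : ∀ k ∈ Finset.Icc (max 1 ⌊(m : ℝ) / c⌋₊) ⌊c * (m : ℝ)⌋₊,
          1 ≤ k ∧ (n : ℝ) ≤ 4 * c * k ∧ (k : ℝ) ≤ (4 * c + r) * n := by
        intro k hk
        obtain ⟨hk₁, hk₂⟩ := Finset.mem_Icc.1 hk
        have hk1 : 1 ≤ k := le_trans (le_max_left _ _) hk₁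
        have hk1' : (1 : ℝ) ≤ k := by exact_mod_cast hk1
        have hfl : (⌊(m : ℝ) / c⌋₊ : ℝ) ≤ k := by
          exact_mod_cast le_trans (le_max_right _ _) hk₁
        have hlt := Nat.lt_floor_add_one ((m : ℝ) / c)
        have hmc : (m : ℝ) / c ≤ 2 * k := by linarith
        rw [div_le_iff₀ hc0] at hmc
        have hkc : (k : ℝ) ≤ c * m := (Nat.le_floor_iff (by positivity)).1 hk₂
        refine ⟨hk1, by nlinarith, ?_⟩
        have h₁ : c * (m : ℝ) ≤ c * n := by gcongr
        have h₂ : 0 ≤ (r : ℝ) * n := by positivity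
        have h₃ : 0 ≤ c * (n : ℝ) := by positivity
        nlinarith
      rw [hW, Finset.mul_sum]
      refine le_trans (Finset.sum_le_sum (g := fun k => 4 * c / n * b k) fun k hk => ?_)
        (Finset.sum_le_sum_of_subset_of_nonneg (fun k hk => ?_) fun k _ _ => ?_)
      · obtain ⟨h₁, h₂, -⟩ := bounds k hk
        have hk0 : (0 : ℝ) < k := by exact_mod_cast h₁
        rw [abs_of_nonneg (hb k), div_eq_mul_one_div, mul_comm]
        refine mul_le_mul_of_nonneg_right ?_ (hb k)
        rw [div_le_div_iff₀ hk0 hn0]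
        linarith
      · obtain ⟨h₁, h₂, h₃⟩ := bounds k hk
        exact mem_window k h₁ h₂ h₃
      · exact mul_nonneg (by positivity) (hb k)
    have hH := H m hm0
    rw [hfirst] at hH
    rw [Finset.sum_Ico_eq_sum_range, Nat.add_sub_cancel_left] at hT
    have := mul_le_mul_of_nonneg_left hsecond hK.le
    linarith
  have shifted : ∑ m ∈ Finset.Icc (n - n / 2) n, ∑ i ∈ Finset.range r, b (m + i) ≤ r * W := by
    rw [Finset.sum_comm]
    have : ∀ i ∈ Finset.range r, ∑ m ∈ Finset.Icc (n - n / 2) n, b (m + i) ≤ W := by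
      intro i hi
      rw [Finset.mem_range] at hi
      rw [← Finset.sum_image (f := b) (g := fun m => m + i)
        fun x _ y _ h => Nat.add_right_cancel h]
      refine Finset.sum_le_sum_of_subset_of_nonneg (fun k hk => ?_) fun k _ _ => hb k
      obtain ⟨m, hm, rfl⟩ := Finset.mem_image.1 hk
      rw [Finset.mem_Icc] at hm
      have h₁ : (n : ℝ) ≤ 2 * (m + i : ℕ) := by exact_mod_cast (by omega : n ≤ 2 * (m + i))
      have h₂ : ((m + i : ℕ) : ℝ) ≤ n + r := by exact_mod_cast (by omega : m + i ≤ n + r)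
      refine mem_window _ (by omega) ?_ ?_
      · nlinarith [Nat.cast_nonneg (α := ℝ) (m + i)]
      · nlinarith
    simpa using Finset.sum_le_sum this
  have hsum := Finset.sum_le_sum pointwise
  have hcard : (Finset.Icc (n - n / 2) n).card = n / 2 + 1 := by
    rw [Nat.card_Icc]
    omega
  rw [Finset.sum_add_distrib, ← Finset.mul_sum, Finset.sum_const, Finset.sum_const, hcard,
    nsmul_eq_mul, nsmul_eq_mul] at hsum
  set N : ℝ := ((n / 2 + 1 : ℕ) : ℝ) with hN
  have hN₁ : (n : ℝ) ≤ 2 * N := by rw [hN]; exact_mod_cast (by omega : n ≤ 2 * (n / 2 + 1))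
  have hN₂ : N ≤ 2 * n := by rw [hN]; exact_mod_cast (by omega : n / 2 + 1 ≤ 2 * n)
  have h₁ : (n : ℝ) * b n ≤ 2 * N * b n := mul_le_mul_of_nonneg_right hN₁ (hb n)
  have h₂ : (1 + K) * ∑ m ∈ Finset.Icc (n - n / 2) n, ∑ i ∈ Finset.range r, b (m + i) ≤
      (1 + K) * (r * W) := mul_le_mul_of_nonneg_left shifted (by positivity)
  have h₃ : N * (K * (4 * c / n * W)) ≤ 2 * n * (K * (4 * c / n * W)) :=
    mul_le_mul_of_nonneg_right hN₂ (by positivity)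
  have h₄ : 2 * (n : ℝ) * (K * (4 * c / n * W)) = 8 * c * K * W := by
    field_simp
    ring
  linarith
end

section
/- Let (b_n)_{n≥1} be a real sequence belonging to GM(β*, 2). If n·|b_n| → 0 as n → ∞, then the series ∑_{n=1}^∞ b_n sin(nx) converges uniformly in x on ℝ. -/
open Finset Filter

/-- If `n |b n| → 0` and `b` is in `GM(β*, 2)`, the dyadic variation of step `2` is `o(1 / m)`. -/
lemma GMstar.eventually_dyadic_variation_le {b : ℕ → ℝ} (hgm : GMstar b 2)
    (hto : Tendsto (fun n : ℕ => (n : ℝ) * |b n|) atTop (nhds 0)) {ε : ℝ} (hε : 0 < ε) :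
    ∀ᶠ m : ℕ in atTop, ∑ n ∈ Finset.Ico m (2 * m), |b n - b (n + 2)| ≤ ε / m := by
  obtain ⟨K, hK, c, hc, h⟩ := hgm
  have hc0 : 0 < c := by linarith
  set δ : ℝ := ε / (K * (2 + 4 * c ^ 3)) with hδ
  have hδ0 : 0 < δ := by positivity
  obtain ⟨L, hL⟩ := eventually_atTop.1 (hto.eventually_le_const hδ0)
  filter_upwards [eventually_ge_atTop (max 1 L), eventually_ge_atTop ⌈c * (L + 1)⌉₊] with m hm hmc
  have hm1 : 1 ≤ m := le_trans (le_max_left _ _) hm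
  have hmL : L ≤ m := le_trans (le_max_right _ _) hm
  have hm0 : (0 : ℝ) < m := by exact_mod_cast hm1
  have hb : ∀ k : ℕ, m ≤ k → |b k| ≤ δ / m := by
    intro k hk
    rw [le_div_iff₀ hm0, mul_comm]
    refine le_trans ?_ (hL k (hmL.trans hk))
    have : (m : ℝ) ≤ k := by exact_mod_cast hk
    gcongr
  have hmc' : (L : ℝ) + 1 ≤ m / c := by
    rw [le_div_iff₀ hc0, mul_comm]
    exact Nat.ceil_le.1 hmc
  have hfl : (m : ℝ) / (2 * c) ≤ ⌊(m : ℝ) / c⌋₊ := by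
    have h1 := Nat.sub_one_lt_floor ((m : ℝ) / c)
    have h2 : (1 : ℝ) ≤ ⌊(m : ℝ) / c⌋₊ := by
      have : 1 ≤ ⌊(m : ℝ) / c⌋₊ := Nat.le_floor (by
        have : (0 : ℝ) ≤ L := by positivity
        push_cast; linarith)
      exact_mod_cast this
    have h3 : (m : ℝ) / (2 * c) = m / c / 2 := by field_simp
    rw [h3]; linarith
  have hLf : L ≤ ⌊(m : ℝ) / c⌋₊ := Nat.le_floor (by linarith)
  have hmid : ∑ k ∈ Finset.Icc (max 1 ⌊(m : ℝ) / c⌋₊) ⌊c * (m : ℝ)⌋₊, |b k| / (k : ℝ)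
      ≤ 4 * c ^ 3 * (δ / m) := by
    have hterm : ∀ k ∈ Finset.Icc (max 1 ⌊(m : ℝ) / c⌋₊) ⌊c * (m : ℝ)⌋₊,
        |b k| / (k : ℝ) ≤ δ / (m / (2 * c)) ^ 2 := by
      intro k hk
      have hk1 := (max_le_iff.1 (Finset.mem_Icc.1 hk).1)
      have hk0 : (0 : ℝ) < k := by exact_mod_cast hk1.1
      have hkf : (m : ℝ) / (2 * c) ≤ k := hfl.trans (by exact_mod_cast hk1.2)
      calc |b k| / (k : ℝ) = (k * |b k|) / k ^ 2 := by field_simp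
        _ ≤ δ / (m / (2 * c)) ^ 2 := by
          have := hL k (hLf.trans hk1.2)
          gcongr
    have hcard : ((Finset.Icc (max 1 ⌊(m : ℝ) / c⌋₊) ⌊c * (m : ℝ)⌋₊).card : ℝ) ≤ c * m := by
      refine le_trans ?_ (Nat.floor_le (by positivity : 0 ≤ c * (m : ℝ)))
      rw [Nat.card_Icc]
      exact_mod_cast (by omega)
    refine (Finset.sum_le_card_nsmul _ _ _ hterm).trans ?_
    rw [nsmul_eq_mul]
    refine (mul_le_mul_of_nonneg_right hcard (by positivity)).trans (le_of_eq ?_)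
    field_simp
    norm_num
  have hfirst : ∑ k ∈ Finset.Icc m (m + 2 - 1), |b k| ≤ 2 * (δ / m) := by
    refine (Finset.sum_le_card_nsmul _ _ _ fun k hk => hb k (Finset.mem_Icc.1 hk).1).trans ?_
    rw [Nat.card_Icc, nsmul_eq_mul, show m + 2 - 1 + 1 - m = 2 by omega]
    norm_num
  have hIcc : Finset.Ico m (2 * m) = Finset.Icc m (2 * m - 1) := by
    ext k; simp only [Finset.mem_Ico, Finset.mem_Icc]; omega
  rw [hIcc]
  refine (h m hm1).trans ((mul_le_mul_of_nonneg_left (add_le_add hfirst hmid) hK.le).trans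
    (le_of_eq ?_))
  rw [hδ]
  field_simp

/-- Dyadic block bounds of size `ε / m` add up to a tail bound of size `2 ε / m`. -/
lemma sum_Ico_le_of_dyadic {a : ℕ → ℝ} (ha : ∀ n, 0 ≤ a n) {ε : ℝ} (hε : 0 ≤ ε) {M : ℕ}
    (h : ∀ m, M ≤ m → ∑ n ∈ Finset.Ico m (2 * m), a n ≤ ε / m) {m : ℕ} (hm : M ≤ m)
    (hm1 : 1 ≤ m) (N : ℕ) : ∑ n ∈ Finset.Ico m N, a n ≤ 2 * ε / m := by
  have hm0 : (0 : ℝ) < m := by exact_mod_cast hm1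
  rcases le_total N (2 * m) with hN | hN
  · refine (Finset.sum_le_sum_of_subset_of_nonneg (Finset.Ico_subset_Ico_right hN)
      fun i _ _ => ha i).trans ((h m hm).trans ?_)
    gcongr
    linarith
  · rw [← Finset.sum_Ico_consecutive _ (by omega : m ≤ 2 * m) hN]
    refine (add_le_add (h m hm)
      (sum_Ico_le_of_dyadic ha hε h (by omega : M ≤ 2 * m) (by omega) N)).trans (le_of_eq ?_)
    push_cast
    field_simp
    norm_num
termination_by N - m

/-- Summation by parts with step `2` for a sine sum. -/
lemma two_mul_sin_mul_sum_Ico (b : ℕ → ℝ) (x : ℝ) {p q : ℕ} (hpq : p ≤ q) :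
    2 * Real.sin x * ∑ n ∈ Finset.Ico p q, b n * Real.sin (n * x) =
      (b p * Real.cos ((p - 1) * x) + b (p + 1) * Real.cos (p * x))
      - (b q * Real.cos ((q - 1) * x) + b (q + 1) * Real.cos (q * x))
      - ∑ n ∈ Finset.Ico p q, (b n - b (n + 2)) * Real.cos ((n + 1) * x) := by
  induction q, hpq using Nat.le_induction with
  | base => simp
  | succ q hq ih =>
    rw [Finset.sum_Ico_succ_top hq, Finset.sum_Ico_succ_top hq, mul_add, ih]
    have h1 : Real.cos ((q - 1 : ℝ) * x) =
        Real.cos (q * x) * Real.cos x + Real.sin (q * x) * Real.sin x := by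
      rw [sub_mul, one_mul, Real.cos_sub]
    have h2 : Real.cos ((q + 1 : ℝ) * x) =
        Real.cos (q * x) * Real.cos x - Real.sin (q * x) * Real.sin x := by
      rw [add_mul, one_mul, Real.cos_add]
    push_cast
    rw [add_sub_cancel_right, h1, h2]
    ring

lemma abs_sin_natCast_mul_le (n : ℕ) (x : ℝ) : |Real.sin (n * x)| ≤ n * |Real.sin x| := by
  induction n with
  | zero => simp
  | succ n ih =>
    push_cast
    rw [add_mul, one_mul, Real.sin_add]
    calc |Real.sin (n * x) * Real.cos x + Real.cos (n * x) * Real.sin x|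
        ≤ |Real.sin (n * x)| * |Real.cos x| + |Real.cos (n * x)| * |Real.sin x| := by
          rw [← abs_mul, ← abs_mul]; exact abs_add_le _ _
      _ ≤ n * |Real.sin x| * 1 + 1 * |Real.sin x| := by
          gcongr
          · exact Real.abs_cos_le_one _
          · exact Real.abs_cos_le_one _
      _ = (n + 1) * |Real.sin x| := by ring

/-- Bound for a block of a sine series near the zeros of `sin`. -/
lemma abs_sum_Ico_mul_sin_le {b : ℕ → ℝ} {ε : ℝ} {p : ℕ}
    (hb : ∀ n, p ≤ n → (n : ℝ) * |b n| ≤ ε) (x : ℝ) {q : ℕ} (hpq : p ≤ q) :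
    |∑ n ∈ Finset.Ico p q, b n * Real.sin (n * x)| ≤ ((q : ℝ) - p) * (ε * |Real.sin x|) := by
  have hterm : ∀ n ∈ Finset.Ico p q, |b n * Real.sin (n * x)| ≤ ε * |Real.sin x| := by
    intro n hn
    rw [abs_mul]
    calc |b n| * |Real.sin (n * x)| ≤ |b n| * (n * |Real.sin x|) := by
          gcongr; exact abs_sin_natCast_mul_le n x
      _ = (n * |b n|) * |Real.sin x| := by ring
      _ ≤ ε * |Real.sin x| := by
          have := hb n (Finset.mem_Ico.1 hn).1
          gcongr
  refine (Finset.abs_sum_le_sum_abs _ _).trans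
    ((Finset.sum_le_card_nsmul _ _ _ hterm).trans (le_of_eq ?_))
  rw [Nat.card_Ico, nsmul_eq_mul, Nat.cast_sub hpq]

/-- Bound for a block of a sine series away from the zeros of `sin`. -/
lemma abs_sin_mul_abs_sum_Ico_le {b : ℕ → ℝ} {ε : ℝ} {p : ℕ} (hp : 1 ≤ p)
    (hb : ∀ n, p ≤ n → (n : ℝ) * |b n| ≤ ε)
    (hv : ∀ N, ∑ n ∈ Finset.Ico p N, |b n - b (n + 2)| ≤ 2 * ε / p)
    (x : ℝ) {q : ℕ} (hpq : p ≤ q) :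
    |Real.sin x| * |∑ n ∈ Finset.Ico p q, b n * Real.sin (n * x)| ≤ 3 * ε / p := by
  have hp0 : (0 : ℝ) < p := by exact_mod_cast hp
  have hcos : ∀ n, p ≤ n → ∀ y, |b n * Real.cos y| ≤ ε / p := by
    intro n hn y
    rw [abs_mul, le_div_iff₀ hp0]
    have : (p : ℝ) ≤ n := by exact_mod_cast hn
    calc |b n| * |Real.cos y| * p ≤ |b n| * 1 * n := by
          gcongr; exact Real.abs_cos_le_one _
      _ ≤ ε := by rw [mul_one, mul_comm]; exact hb n hn
  have hsum : |∑ n ∈ Finset.Ico p q, (b n - b (n + 2)) * Real.cos ((n + 1) * x)| ≤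
      2 * ε / p := by
    refine (Finset.abs_sum_le_sum_abs _ _).trans ((Finset.sum_le_sum fun n _ => ?_).trans (hv q))
    rw [abs_mul]
    exact mul_le_of_le_one_right (abs_nonneg _) (Real.abs_cos_le_one _)
  have key := congrArg abs (two_mul_sin_mul_sum_Ico b x hpq)
  rw [abs_mul, abs_mul, abs_two] at key
  have h1 := abs_le.1 (hcos p le_rfl ((p - 1) * x))
  have h2 := abs_le.1 (hcos (p + 1) (by omega) (p * x))
  have h3 := abs_le.1 (hcos q hpq ((q - 1) * x))
  have h4 := abs_le.1 (hcos (q + 1) (by omega) (q * x))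
  have h5 := abs_le.1 hsum
  rw [mul_div_assoc] at h5 ⊢
  have : 2 * |Real.sin x| * |∑ n ∈ Finset.Ico p q, b n * Real.sin (n * x)| ≤ 6 * (ε / p) := by
    rw [key, abs_le]
    constructor <;> linarith [h1.1, h1.2, h2.1, h2.2, h3.1, h3.2, h4.1, h4.2, h5.1, h5.2]
  linarith

/-- Uniform bound for a block of a sine series, splitting the block at `p + ⌊1 / |sin x|⌋`. -/
lemma abs_sum_Ico_mul_sin_le_four_mul {b : ℕ → ℝ} {ε : ℝ} (hε : 0 ≤ ε) {p : ℕ} (hp : 1 ≤ p)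
    (hb : ∀ n, p ≤ n → (n : ℝ) * |b n| ≤ ε)
    (hv : ∀ m, p ≤ m → ∀ N, ∑ n ∈ Finset.Ico m N, |b n - b (n + 2)| ≤ 2 * ε / m)
    (x : ℝ) {q : ℕ} (hpq : p ≤ q) :
    |∑ n ∈ Finset.Ico p q, b n * Real.sin (n * x)| ≤ 4 * ε := by
  rcases (abs_nonneg (Real.sin x)).eq_or_lt with hs | hs
  · refine (abs_sum_Ico_mul_sin_le hb x hpq).trans ?_
    rw [← hs]
    linarith
  set r := p + ⌊1 / |Real.sin x|⌋₊ with hr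
  have hpr : p ≤ r := Nat.le_add_right _ _
  have hshort : ∀ q', p ≤ q' → q' ≤ r →
      |∑ n ∈ Finset.Ico p q', b n * Real.sin (n * x)| ≤ ε := by
    intro q' h1 h2
    refine (abs_sum_Ico_mul_sin_le hb x h1).trans ?_
    have h3 : (q' : ℝ) - p ≤ 1 / |Real.sin x| := by
      refine le_trans ?_ (Nat.floor_le (by positivity : 0 ≤ 1 / |Real.sin x|))
      have : (q' : ℝ) ≤ p + ⌊1 / |Real.sin x|⌋₊ := by exact_mod_cast h2
      linarith
    refine (mul_le_mul_of_nonneg_right h3 (by positivity)).trans (le_of_eq ?_)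
    field_simp
  rcases le_total q r with hqr | hqr
  · linarith [hshort q hpq hqr]
  · rw [← Finset.sum_Ico_consecutive _ hpr hqr]
    refine (abs_add_le _ _).trans ?_
    have hr1 : 1 / |Real.sin x| ≤ r := by
      have h1 := (Nat.lt_floor_add_one (1 / |Real.sin x|)).le
      have h2 : (1 : ℝ) ≤ p := by exact_mod_cast hp
      rw [hr]; push_cast; linarith
    have hr0 : (0 : ℝ) < r := by exact_mod_cast hp.trans hpr
    have hlong := abs_sin_mul_abs_sum_Ico_le (hp.trans hpr) (fun n hn => hb n (hpr.trans hn))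
      (hv r hpr) x hqr
    rw [div_le_iff₀ hs] at hr1
    have : |∑ n ∈ Finset.Ico r q, b n * Real.sin (n * x)| ≤ 3 * ε := by
      rw [le_div_iff₀ hr0] at hlong
      refine le_trans ?_ hlong
      have := mul_le_mul_of_nonneg_right hr1
        (abs_nonneg (∑ n ∈ Finset.Ico r q, b n * Real.sin (n * x)))
      linarith
    linarith [hshort r hpr le_rfl]

lemma sinePartialSum_sub (b : ℕ → ℝ) (x : ℝ) {p q : ℕ} (hpq : p ≤ q) :
    sinePartialSum b q x - sinePartialSum b p x =
      ∑ n ∈ Finset.Ico (p + 1) (q + 1), b n * Real.sin (n * x) := by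
  have hIcc : ∀ N, Finset.Icc 1 N = Finset.Ico 1 (N + 1) := by
    intro N; ext k; simp only [Finset.mem_Ico, Finset.mem_Icc]; omega
  rw [sinePartialSum, sinePartialSum, hIcc, hIcc, ← Finset.sum_Ico_consecutive _
    (by omega : 1 ≤ p + 1) (by omega : p + 1 ≤ q + 1), add_sub_cancel_left]

theorem sufficiency_of_nbn_to_zero
    (b : ℕ → ℝ) (hgm : GMstar b 2)
    (hto : Tendsto (fun n : ℕ => (n : ℝ) * |b n|) atTop (nhds 0)) :
    ∃ f : ℝ → ℝ, TendstoUniformly (fun N x => sinePartialSum b N x) f atTop := by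
  have hU : UniformCauchySeqOn (fun N x => sinePartialSum b N x) atTop Set.univ := by
    rw [Metric.uniformCauchySeqOn_iff]
    intro ε hε
    have hδ : 0 < ε / 5 := by positivity
    obtain ⟨M, hM⟩ := eventually_atTop.1
      ((hgm.eventually_dyadic_variation_le hto hδ).and (hto.eventually_le_const hδ))
    have hle : ∀ p, M ≤ p → ∀ q, p ≤ q → ∀ x,
        dist (sinePartialSum b q x) (sinePartialSum b p x) < ε := by
      intro p hp q hpq x
      rw [Real.dist_eq, sinePartialSum_sub b x hpq]
      refine (abs_sum_Ico_mul_sin_le_four_mul hδ.le (by omega)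
        (fun n hn => (hM n (by omega)).2) (fun m hm N => ?_) x (by omega)).trans_lt (by linarith)
      exact sum_Ico_le_of_dyadic (fun n => abs_nonneg _) hδ.le (fun k hk => (hM k hk).1)
        (by omega) (by omega) N
    refine ⟨M, fun m hm n hn x _ => ?_⟩
    rcases le_total m n with h | h
    · rw [dist_comm]; exact hle m hm n h x
    · exact hle n hn m h x
  choose f hf using fun x => cauchySeq_tendsto_of_complete (hU.cauchySeq (Set.mem_univ x))
  exact ⟨f, tendstoUniformlyOn_univ.1 (hU.tendstoUniformlyOn_of_tendsto fun x _ => hf x)⟩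
end

section
/- There exist a real number x₀ and a nonnegative real sequence (d_n)_{n≥1} belonging to GM(β*, 3) with n·d_n → 0 as n → ∞, such that the series ∑_{n=1}^∞ d_n sin(n x₀) diverges. -/
open Finset Filter

/-- The sequence supported on `n ≡ 1 (mod 3)` with value `1 / ((n + 1) log (n + 1))` there. -/
noncomputable def lacunaryLogSeq (n : ℕ) : ℝ :=
  if n % 3 = 1 then 1 / (((n : ℝ) + 1) * Real.log ((n : ℝ) + 1)) else 0

lemma lacunaryLogSeq_nonneg (n : ℕ) : 0 ≤ lacunaryLogSeq n := by
  unfold lacunaryLogSeq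
  split_ifs
  · have : 0 ≤ Real.log ((n : ℝ) + 1) := Real.log_nonneg (by linarith [n.cast_nonneg (α := ℝ)])
    positivity
  · exact le_rfl

lemma lacunaryLogSeq_add_three_le (n : ℕ) : lacunaryLogSeq (n + 3) ≤ lacunaryLogSeq n := by
  unfold lacunaryLogSeq
  rw [Nat.add_mod_right]
  split_ifs with h
  · have hn : (1 : ℝ) ≤ n := by exact_mod_cast (show 1 ≤ n by omega)
    have hlog : 0 < Real.log ((n : ℝ) + 1) := Real.log_pos (by linarith)
    push_cast
    gcongr <;> linarith
  · exact le_rfl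

lemma tendsto_natCast_mul_lacunaryLogSeq :
    Tendsto (fun n : ℕ => (n : ℝ) * lacunaryLogSeq n) atTop (nhds 0) := by
  have hlim : Tendsto (fun n : ℕ => (Real.log ((n : ℝ) + 1))⁻¹) atTop (nhds 0) :=
    tendsto_inv_atTop_zero.comp (Real.tendsto_log_atTop.comp
      (tendsto_atTop_add_const_right _ _ tendsto_natCast_atTop_atTop))
  refine squeeze_zero (fun n => mul_nonneg n.cast_nonneg (lacunaryLogSeq_nonneg n)) (fun n => ?_)
    hlim
  have hn : (0 : ℝ) ≤ n := n.cast_nonneg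
  have hlog : 0 ≤ Real.log ((n : ℝ) + 1) := Real.log_nonneg (by linarith)
  unfold lacunaryLogSeq
  split_ifs
  · rw [one_div, mul_inv, ← mul_assoc]
    refine mul_le_of_le_one_left (inv_nonneg.2 hlog) ?_
    rw [← div_eq_mul_inv, div_le_one (by linarith)]
    linarith
  · simpa using hlog

lemma sum_Ico_sub_add_three (b : ℕ → ℝ) (m p : ℕ) :
    ∑ n ∈ Finset.Ico m (m + p), (b n - b (n + 3)) =
      (b m + b (m + 1) + b (m + 2)) - (b (m + p) + b (m + p + 1) + b (m + p + 2)) := by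
  induction p with
  | zero => simp
  | succ p ih =>
    rw [← add_assoc, Finset.sum_Ico_succ_top (by omega), ih,
      show m + p + 1 + 1 = m + p + 2 by ring, show m + p + 1 + 2 = m + p + 3 by ring]
    ring

/-- A nonnegative sequence that decreases along each residue class mod `3` is in `GM(β*, 3)`. -/
lemma GMstar_three_of_add_three_le {b : ℕ → ℝ} (hb : ∀ n, 0 ≤ b n)
    (hanti : ∀ n, b (n + 3) ≤ b n) : GMstar b 3 := by
  refine ⟨1, one_pos, 2, one_lt_two, fun m hm => ?_⟩
  have hleft : ∑ n ∈ Finset.Icc m (2 * m - 1), |b n - b (n + 3)| ≤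
      b m + b (m + 1) + b (m + 2) := by
    have hIcc : Finset.Icc m (2 * m - 1) = Finset.Ico m (m + m) := by
      ext; simp only [Finset.mem_Icc, Finset.mem_Ico]; omega
    rw [hIcc, Finset.sum_congr rfl fun n _ => abs_of_nonneg (sub_nonneg.2 (hanti n)),
      sum_Ico_sub_add_three]
    linarith [hb (m + m), hb (m + m + 1), hb (m + m + 2)]
  have hright : ∑ k ∈ Finset.Icc m (m + 3 - 1), |b k| = b m + b (m + 1) + b (m + 2) := by
    have hIcc : Finset.Icc m (m + 3 - 1) = Finset.Ico m (m + 2 + 1) := by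
      ext; simp only [Finset.mem_Icc, Finset.mem_Ico]; omega
    rw [hIcc, Finset.sum_congr rfl fun n _ => abs_of_nonneg (hb n),
      Finset.sum_Ico_succ_top (by omega), Finset.sum_Ico_succ_top (by omega),
      Finset.sum_Ico_succ_top (by omega)]
    simp
  have hrest : 0 ≤ ∑ k ∈ Finset.Icc (max 1 ⌊(m : ℝ) / 2⌋₊) ⌊2 * (m : ℝ)⌋₊, |b k| / (k : ℝ) :=
    Finset.sum_nonneg fun k _ => by positivity
  rw [one_mul, hright]
  linarith

lemma log_log_add_three_sub_le {x : ℝ} (hx : 1 < x) :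
    Real.log (Real.log (x + 3)) - Real.log (Real.log x) ≤ 3 * (1 / (x * Real.log x)) := by
  have hx0 : 0 < x := by linarith
  have hlog : 0 < Real.log x := Real.log_pos hx
  have hlog3 : 0 < Real.log (x + 3) := Real.log_pos (by linarith)
  have hstep : Real.log (x + 3) - Real.log x ≤ 3 / x := by
    rw [← Real.log_div (by linarith) hx0.ne']
    refine (Real.log_le_sub_one_of_pos (by positivity)).trans_eq ?_
    field_simp
    ring
  calc Real.log (Real.log (x + 3)) - Real.log (Real.log x)
      = Real.log (Real.log (x + 3) / Real.log x) := (Real.log_div hlog3.ne' hlog.ne').symm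
    _ ≤ Real.log (x + 3) / Real.log x - 1 := Real.log_le_sub_one_of_pos (by positivity)
    _ = (Real.log (x + 3) - Real.log x) / Real.log x := by field_simp
    _ ≤ 3 / x / Real.log x := by gcongr
    _ = 3 * (1 / (x * Real.log x)) := by field_simp

lemma sin_two_pi_div_three : Real.sin (2 * Real.pi / 3) = √3 / 2 := by
  rw [show 2 * Real.pi / 3 = Real.pi - Real.pi / 3 by ring, Real.sin_pi_sub, Real.sin_pi_div_three]

lemma sinePartialSum_lacunaryLogSeq_succ (k : ℕ) :
    sinePartialSum lacunaryLogSeq (3 * (k + 1)) (2 * Real.pi / 3) =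
      sinePartialSum lacunaryLogSeq (3 * k) (2 * Real.pi / 3) +
        1 / ((3 * (k : ℝ) + 2) * Real.log (3 * (k : ℝ) + 2)) * (√3 / 2) := by
  have hone : lacunaryLogSeq (3 * k + 1) =
      1 / ((3 * (k : ℝ) + 2) * Real.log (3 * (k : ℝ) + 2)) := by
    rw [lacunaryLogSeq, if_pos (by omega)]
    push_cast
    rw [show 3 * (k : ℝ) + 1 + 1 = 3 * k + 2 by ring]
  have htwo : lacunaryLogSeq (3 * k + 2) = 0 := if_neg (by omega)
  have hthree : lacunaryLogSeq (3 * k + 3) = 0 := if_neg (by omega)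
  have hsin : Real.sin (((3 * k + 1 : ℕ) : ℝ) * (2 * Real.pi / 3)) = √3 / 2 := by
    rw [← sin_two_pi_div_three, ← Real.sin_add_nat_mul_two_pi (2 * Real.pi / 3) k]
    congr 1
    push_cast
    ring
  unfold sinePartialSum
  rw [show 3 * (k + 1) = 3 * k + 1 + 1 + 1 by ring, Finset.sum_Icc_succ_top (by omega),
    Finset.sum_Icc_succ_top (by omega), Finset.sum_Icc_succ_top (by omega), hsin, hone, htwo,
    hthree]
  ring

lemma log_log_le_sinePartialSum (k : ℕ) :
    √3 / 6 * (Real.log (Real.log (3 * (k : ℝ) + 2)) - Real.log (Real.log 2)) ≤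
      sinePartialSum lacunaryLogSeq (3 * k) (2 * Real.pi / 3) := by
  induction k with
  | zero => simp [sinePartialSum]
  | succ k ih =>
    have hx : (1 : ℝ) < 3 * k + 2 := by linarith [k.cast_nonneg (α := ℝ)]
    have hstep := mul_le_mul_of_nonneg_left (log_log_add_three_sub_le hx)
      (show 0 ≤ √3 / 6 by positivity)
    rw [sinePartialSum_lacunaryLogSeq_succ]
    push_cast
    rw [show 3 * ((k : ℝ) + 1) + 2 = 3 * k + 2 + 3 by ring]
    linarith

lemma tendsto_sinePartialSum_lacunaryLogSeq_atTop :
    Tendsto (fun k : ℕ => sinePartialSum lacunaryLogSeq (3 * k) (2 * Real.pi / 3))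
      atTop atTop := by
  refine tendsto_atTop_mono log_log_le_sinePartialSum ?_
  refine Tendsto.const_mul_atTop (by positivity) ?_
  refine tendsto_atTop_add_const_right _ _ ?_
  exact Real.tendsto_log_atTop.comp (Real.tendsto_log_atTop.comp (tendsto_atTop_add_const_right _ _
    (tendsto_natCast_atTop_atTop.const_mul_atTop (by norm_num))))

theorem exists_divergent_sine_series_in_gm_star_three :
    ∃ x₀ : ℝ, ∃ d : ℕ → ℝ, (∀ n, 0 ≤ d n) ∧ GMstar d 3 ∧
      Tendsto (fun n : ℕ => (n : ℝ) * d n) atTop (nhds 0) ∧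
      ¬ ∃ L : ℝ, Tendsto (fun N => sinePartialSum d N x₀) atTop (nhds L) := by
  refine ⟨2 * Real.pi / 3, lacunaryLogSeq, lacunaryLogSeq_nonneg,
    GMstar_three_of_add_three_le lacunaryLogSeq_nonneg lacunaryLogSeq_add_three_le,
    tendsto_natCast_mul_lacunaryLogSeq, ?_⟩
  rintro ⟨L, hL⟩
  exact not_tendsto_nhds_of_tendsto_atTop tendsto_sinePartialSum_lacunaryLogSeq_atTop L
    (hL.comp (tendsto_id.const_mul_atTop' (show 0 < 3 by norm_num)))
end

section
/- Let r ≥ 3 be a natural number and define a_n = 0 if r ∣ n and a_n = 1/(n·ln(n+1)) if r ∤ n (n ≥ 1). Then (a_n) belongs to GM(β*, r); more precisely, for every c > 1 there is a constant K > 0 such that for all m ≥ 1, ∑_{k=m}^{2m-1} |a_k − a_{k+r}| ≤ K·∑_{k=max(1,⌊m/c⌋)}^{⌊cm⌋} a_k/k. -/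
open Finset

/-- Telescoping with step `r` of a nonnegative sequence that decreases from `m` on. -/
lemma sum_Ico_sub_shift_le {f : ℕ → ℝ} {m : ℕ} (hf : AntitoneOn f (Set.Ici m))
    (h0 : ∀ k, 0 ≤ f k) (r : ℕ) {n : ℕ} (hmn : m ≤ n) :
    ∑ k ∈ Finset.Ico m n, (f k - f (k + r)) ≤ r * f m := by
  have htel (r : ℕ) :
      ∑ k ∈ Finset.Ico m n, (f (k + r) - f (k + r + 1)) = f (m + r) - f (n + r) := by
    induction n, hmn using Nat.le_induction with
    | base => simp
    | succ n hn ih =>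
      rw [Finset.sum_Ico_succ_top hn, ih, Nat.add_right_comm n 1 r]
      ring
  induction r with
  | zero => simp
  | succ r ih =>
    have hle : f (m + r) ≤ f m :=
      hf Set.self_mem_Ici (Set.mem_Ici.2 (Nat.le_add_right m r)) (Nat.le_add_right m r)
    calc ∑ k ∈ Finset.Ico m n, (f k - f (k + (r + 1)))
        = ∑ k ∈ Finset.Ico m n, (f k - f (k + r))
          + ∑ k ∈ Finset.Ico m n, (f (k + r) - f (k + r + 1)) := by
          rw [← Finset.sum_add_distrib]
          exact Finset.sum_congr rfl fun k _ => by rw [← add_assoc]; ring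
      _ ≤ r * f m + f m := by
          rw [htel]
          linarith [h0 (n + r)]
      _ = ((r + 1 : ℕ) : ℝ) * f m := by push_cast; ring

/-- At least about half of the integers of an interval are not divisible by `r ≥ 2`. -/
lemma sub_add_ite_dvd_le_two_mul_sum {r : ℕ} (hr : 2 ≤ r) {l m : ℕ} (hlm : l ≤ m) :
    (m : ℝ) - l + (if r ∣ m then 0 else 1) ≤
      2 * ∑ k ∈ Finset.Icc l m, (if r ∣ k then (0 : ℝ) else 1) := by
  induction m, hlm using Nat.le_induction with
  | base =>
    simp only [Finset.Icc_self, Finset.sum_singleton]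
    split_ifs <;> norm_num
  | succ m hm ih =>
    rw [Finset.sum_Icc_succ_top (by omega)]
    have hnot : ¬ (r ∣ m ∧ r ∣ m + 1) := fun ⟨h₁, h₂⟩ => by
      have := Nat.le_of_dvd one_pos ((Nat.dvd_add_right h₁).1 h₂)
      omega
    push_cast
    split_ifs at ih ⊢ <;> first | linarith | tauto

lemma antitoneOn_one_div_mul_log :
    AntitoneOn (fun n : ℕ => 1 / ((n : ℝ) * Real.log (n + 1))) (Set.Ici 1) := by
  intro j hj k _ hjk
  have hj1 : (1 : ℝ) ≤ j := by exact_mod_cast Set.mem_Ici.1 hj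
  have hjk' : (j : ℝ) ≤ k := by exact_mod_cast hjk
  have hlog : 0 < Real.log ((j : ℝ) + 1) := Real.log_pos (by linarith)
  have hle : Real.log ((j : ℝ) + 1) ≤ Real.log ((k : ℝ) + 1) :=
    Real.log_le_log (by linarith) (by linarith)
  exact one_div_le_one_div_of_le (by positivity)
    (mul_le_mul hjk' hle hlog.le (by linarith))

theorem log_example_in_gm_star
    (r : ℕ) (hr : 3 ≤ r) (a : ℕ → ℝ)
    (ha : ∀ n : ℕ, a n = if r ∣ n then 0 else 1 / ((n : ℝ) * Real.log (n + 1))) :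
    ∀ c : ℝ, 1 < c → ∃ K : ℝ, 0 < K ∧ ∀ m : ℕ, 1 ≤ m →
      (∑ k ∈ Finset.Icc m (2 * m - 1), |a k - a (k + r)|) ≤
        K * ∑ k ∈ Finset.Icc (max 1 ⌊(m : ℝ) / c⌋₊) ⌊c * (m : ℝ)⌋₊, a k / (k : ℝ) := by
  intro c hc
  have hc0 : 0 < c := by linarith
  have hδ : 0 < 1 - 1 / c := by
    rw [sub_pos, div_lt_one hc0]
    exact hc
  have hr0 : (0 : ℝ) < r := by exact_mod_cast (by omega : 0 < r)
  refine ⟨4 * r / (1 - 1 / c), by positivity, fun m hm => ?_⟩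
  set f : ℕ → ℝ := fun n => 1 / ((n : ℝ) * Real.log (n + 1))
  have hf0 : ∀ k, 0 ≤ f k := fun k => by
    have : 0 ≤ Real.log ((k : ℝ) + 1) := Real.log_nonneg (by simp)
    positivity
  have hanti : AntitoneOn f (Set.Ici 1) := antitoneOn_one_div_mul_log
  have haf : ∀ k, a k = if r ∣ k then 0 else f k := ha
  have ha0 : ∀ k, 0 ≤ a k := fun k => by
    rw [haf]
    split_ifs
    exacts [le_rfl, hf0 k]
  have hm0 : (0 : ℝ) < m := by exact_mod_cast hm
  have hupper : ∑ k ∈ Finset.Icc m (2 * m - 1), |a k - a (k + r)| ≤ r * f m := by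
    have hIcc : Finset.Icc m (2 * m - 1) = Finset.Ico m (2 * m) := by
      ext k
      simp only [Finset.mem_Icc, Finset.mem_Ico]
      omega
    rw [hIcc]
    refine le_trans (Finset.sum_le_sum fun k hk => ?_) (sum_Ico_sub_shift_le
      (hanti.mono (Set.Ici_subset_Ici.2 hm)) hf0 r (by omega : m ≤ 2 * m))
    have hk1 : 1 ≤ k := hm.trans (Finset.mem_Ico.1 hk).1
    have hle : f (k + r) ≤ f k :=
      hanti (Set.mem_Ici.2 hk1) (Set.mem_Ici.2 (by omega)) (Nat.le_add_right k r)
    simp only [haf, Nat.dvd_add_self_right]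
    split_ifs
    · simpa using hle
    · rw [abs_of_nonneg (sub_nonneg.2 hle)]
  set l := max 1 ⌊(m : ℝ) / c⌋₊ with hl
  have hfloor : (⌊(m : ℝ) / c⌋₊ : ℝ) ≤ m / c := Nat.floor_le (by positivity)
  have hlm : l ≤ m := by
    refine max_le hm (Nat.cast_le (α := ℝ).1 (hfloor.trans (div_le_self hm0.le hc.le)))
  have hmc : m ≤ ⌊c * (m : ℝ)⌋₊ := Nat.le_floor (le_mul_of_one_le_left hm0.le hc.le)
  have hlower : (∑ k ∈ Finset.Icc l m, (if r ∣ k then (0 : ℝ) else 1)) * (f m / m) ≤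
      ∑ k ∈ Finset.Icc l ⌊c * (m : ℝ)⌋₊, a k / (k : ℝ) := by
    rw [Finset.sum_mul]
    refine le_trans (Finset.sum_le_sum fun k hk => ?_) (Finset.sum_le_sum_of_subset_of_nonneg
      (Finset.Icc_subset_Icc_right hmc) fun k _ _ => div_nonneg (ha0 k) k.cast_nonneg)
    obtain ⟨hlk, hkm⟩ := Finset.mem_Icc.1 hk
    have hk1 : 1 ≤ k := (le_max_left _ _).trans hlk
    have hk0 : (0 : ℝ) < k := by exact_mod_cast hk1
    rw [haf]
    split_ifs
    · simp
    · rw [one_mul]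
      exact div_le_div₀ (hf0 k) (hanti (Set.mem_Ici.2 hk1) (Set.mem_Ici.2 hm) hkm) hk0
        (by exact_mod_cast hkm)
  have hcount : m * (1 - 1 / c) / 4 ≤ ∑ k ∈ Finset.Icc l m, (if r ∣ k then (0 : ℝ) else 1) := by
    have hhalf := sub_add_ite_dvd_le_two_mul_sum (by omega : 2 ≤ r) hlm
    have hpos : (0 : ℝ) < m * (1 - 1 / c) := by positivity
    have hlt : (m : ℝ) * (1 - 1 / c) ≤ m :=
      mul_le_of_le_one_right hm0.le (by linarith [one_div_pos.2 hc0])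
    have hite : (0 : ℝ) ≤ if r ∣ m then 0 else 1 := by split_ifs <;> norm_num
    rcases max_choice 1 ⌊(m : ℝ) / c⌋₊ with h | h
    · rw [← hl] at h
      rw [h] at hhalf ⊢
      rcases hm.eq_or_lt with rfl | hm2
      · rw [if_neg (by rw [Nat.dvd_one]; omega)] at hhalf
        push_cast at *
        linarith
      · have : (2 : ℝ) ≤ m := by exact_mod_cast hm2
        push_cast at hhalf
        linarith
    · have hl' : (l : ℝ) ≤ m / c := by
        rw [hl, h]
        exact hfloor
      have : (m : ℝ) * (1 - 1 / c) = m - m / c := by ring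
      linarith
  calc ∑ k ∈ Finset.Icc m (2 * m - 1), |a k - a (k + r)| ≤ r * f m := hupper
    _ = 4 * r / (1 - 1 / c) * (m * (1 - 1 / c) / 4 * (f m / m)) := by
        have := hδ.ne'
        generalize 1 - 1 / c = δ at *
        field_simp
    _ ≤ 4 * r / (1 - 1 / c) * ∑ k ∈ Finset.Icc l ⌊c * (m : ℝ)⌋₊, a k / (k : ℝ) := by
        refine mul_le_mul_of_nonneg_left (le_trans ?_ hlower) (by positivity)
        exact mul_le_mul_of_nonneg_right hcount (div_nonneg (hf0 m) hm0.le)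
end

section
/- Let r ≥ 3 be a natural number and define a_n = 0 if r ∣ n and a_n = 1/(n·ln(n+1)) if r ∤ n (n ≥ 1). Then (a_n) does not belong to GM(β*, 2): for no constant K > 0 and real c > 1 does the inequality ∑_{k=n}^{2n-1} |a_k − a_{k+2}| ≤ K·( a_n + a_{n+1} + ∑_{k=max(1,⌊n/c⌋)}^{⌊cn⌋} a_k/k ) hold for all n ≥ 1. -/
open Finset

/-- The sequence `1 / (n log (n + 1))` with the multiples of `r` removed is at most `2 / n`. -/
lemma ite_dvd_inv_mul_log_le (r n : ℕ) (hn : 1 ≤ n) :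
    (if r ∣ n then 0 else 1 / ((n : ℝ) * Real.log (n + 1))) ≤ 2 / (n : ℝ) := by
  have hn' : (1 : ℝ) ≤ n := by exact_mod_cast hn
  split_ifs
  · positivity
  · have hlog : 1 / 2 ≤ Real.log ((n : ℝ) + 1) :=
      (by linarith [Real.log_two_gt_d9] : (1 / 2 : ℝ) ≤ Real.log 2).trans
        (Real.log_le_log (by norm_num) (by linarith))
    rw [div_le_div_iff₀ (by positivity) (by linarith)]
    nlinarith

/-- A sequence bounded by `B / k` satisfies `∑ a k / k ≤ 4 B c ^ 3 / n` over `n / c ≤ k ≤ c n`. -/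
lemma sum_Icc_div_le {a : ℕ → ℝ} {B c : ℝ} (hB : 0 ≤ B) (hc : 0 < c)
    (ha : ∀ k : ℕ, 1 ≤ k → a k ≤ B / k) {n : ℕ} (hn : 1 ≤ n) :
    ∑ k ∈ Icc (max 1 ⌊(n : ℝ) / c⌋₊) ⌊c * (n : ℝ)⌋₊, a k / (k : ℝ) ≤ 4 * B * c ^ 3 / n := by
  have hn' : (0 : ℝ) < n := by exact_mod_cast hn
  have hterm : ∀ k ∈ Icc (max 1 ⌊(n : ℝ) / c⌋₊) ⌊c * (n : ℝ)⌋₊,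
      a k / (k : ℝ) ≤ 4 * B * c ^ 2 / (n : ℝ) ^ 2 := by
    intro k hk
    obtain ⟨hk₁, hk₂⟩ := max_le_iff.mp (mem_Icc.mp hk).1
    have hk' : (1 : ℝ) ≤ k := by exact_mod_cast hk₁
    have hlt : (n : ℝ) / c < k + 1 := by
      have := Nat.lt_floor_add_one ((n : ℝ) / c)
      have : ((⌊(n : ℝ) / c⌋₊ : ℕ) : ℝ) ≤ k := by exact_mod_cast hk₂
      linarith
    have hle : (n : ℝ) ≤ 2 * c * k := by
      rw [div_lt_iff₀ hc] at hlt
      nlinarith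
    have hsq : (n : ℝ) ^ 2 ≤ 4 * c ^ 2 * (k : ℝ) ^ 2 := by
      calc (n : ℝ) ^ 2 ≤ (2 * c * k) ^ 2 := by gcongr
        _ = _ := by ring
    calc a k / (k : ℝ) ≤ B / k / k := by gcongr; exact ha k hk₁
      _ = B / (k : ℝ) ^ 2 := by rw [div_div, sq]
      _ ≤ _ := by
        rw [div_le_div_iff₀ (by positivity) (by positivity)]
        nlinarith [mul_le_mul_of_nonneg_left hsq hB]
  have hcard : ((Icc (max 1 ⌊(n : ℝ) / c⌋₊) ⌊c * (n : ℝ)⌋₊).card : ℝ) ≤ c * n := by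
    refine le_trans ?_ (Nat.floor_le (by positivity : 0 ≤ c * (n : ℝ)))
    rw [Nat.card_Icc]
    exact_mod_cast (by omega)
  calc _ ≤ ((Icc (max 1 ⌊(n : ℝ) / c⌋₊) ⌊c * (n : ℝ)⌋₊).card : ℝ) *
        (4 * B * c ^ 2 / (n : ℝ) ^ 2) := by
        simpa only [nsmul_eq_mul] using sum_le_card_nsmul _ _ _ hterm
    _ ≤ c * n * (4 * B * c ^ 2 / (n : ℝ) ^ 2) := by gcongr
    _ = _ := by field_simp

/-- The second differences of the sequence over `[n, 2n)`, `n = r m`, add up to at least a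
constant multiple of `1 / log (2n + 1)`. -/
lemma le_sum_abs_sub_add_two {r : ℕ} (hr : 3 ≤ r) {a : ℕ → ℝ}
    (ha : ∀ n : ℕ, a n = if r ∣ n then 0 else 1 / ((n : ℝ) * Real.log (n + 1)))
    {m : ℕ} (hm : 1 ≤ m) :
    1 / (2 * r * Real.log (2 * (r * m : ℕ) + 1)) ≤
      ∑ k ∈ Icc (r * m) (2 * (r * m) - 1), |a k - a (k + 2)| := by
  have hm' : (0 : ℝ) < m := by exact_mod_cast hm
  have hr' : (0 : ℝ) < r := by exact_mod_cast (by omega : 0 < r)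
  have hinj : Set.InjOn (fun j => r * (m + j)) (range m) := by
    intro i _ j _ hij
    have := Nat.eq_of_mul_eq_mul_left (by omega : 0 < r) hij
    omega
  have hsub : (range m).image (fun j => r * (m + j)) ⊆ Icc (r * m) (2 * (r * m) - 1) := by
    intro k hk
    obtain ⟨j, hj, rfl⟩ := mem_image.mp hk
    have hj' : r * (j + 1) ≤ r * m := Nat.mul_le_mul_left r (mem_range.mp hj)
    rw [mem_Icc]
    constructor <;> simp only [mul_add] at * <;> omega
  have hterm : ∀ j ∈ range m, 1 / (2 * (r * m : ℕ) * Real.log (2 * (r * m : ℕ) + 1)) ≤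
      |a (r * (m + j)) - a (r * (m + j) + 2)| := by
    intro j hj
    have hndvd : ¬ r ∣ r * (m + j) + 2 := fun h =>
      absurd (Nat.le_of_dvd two_pos ((Nat.dvd_add_right (dvd_mul_right _ _)).mp h)) (by omega)
    have hle : r * (m + j) + 2 ≤ 2 * (r * m) := by
      have hj' : r * (j + 1) ≤ r * m := Nat.mul_le_mul_left r (mem_range.mp hj)
      simp only [mul_add] at *
      omega
    have hle' : ((r * (m + j) + 2 : ℕ) : ℝ) ≤ 2 * (r * m : ℕ) := by exact_mod_cast hle
    have hpos : (0 : ℝ) < (r * (m + j) + 2 : ℕ) := by positivity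
    rw [ha, ha (_ + 2), if_pos (dvd_mul_right _ _), if_neg hndvd, zero_sub, abs_neg]
    refine le_trans ?_ (le_abs_self _)
    have hlog : 0 < Real.log ((r * (m + j) + 2 : ℕ) + 1) := Real.log_pos (by linarith)
    gcongr
  calc _ = (range m).card • (1 / (2 * (r * m : ℕ) * Real.log (2 * (r * m : ℕ) + 1))) := by
        rw [card_range, nsmul_eq_mul]
        push_cast
        field_simp
    _ ≤ ∑ j ∈ range m, |a (r * (m + j)) - a (r * (m + j) + 2)| := card_nsmul_le_sum _ _ _ hterm
    _ = ∑ k ∈ (range m).image (fun j => r * (m + j)), |a k - a (k + 2)| := by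
        rw [sum_image hinj]
    _ ≤ _ := sum_le_sum_of_subset_of_nonneg hsub fun _ _ _ => abs_nonneg _

lemma eventually_mul_log_two_mul_add_one_lt {D : ℝ} (hD : 0 < D) :
    ∀ᶠ n : ℕ in Filter.atTop, D * Real.log (2 * n + 1) < n := by
  have htends : Filter.Tendsto (fun n : ℕ => 2 * (n : ℝ) + 1) Filter.atTop Filter.atTop :=
    Filter.tendsto_atTop_add_const_right _ _
      (tendsto_natCast_atTop_atTop.const_mul_atTop two_pos)
  filter_upwards [htends.eventually
    (Real.isLittleO_log_id_atTop.bound (by positivity : 0 < 1 / (4 * D))),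
    Filter.eventually_ge_atTop 1] with n hn hn1
  have hn1' : (1 : ℝ) ≤ n := by exact_mod_cast hn1
  have h := (le_abs_self _).trans hn
  rw [id, Real.norm_of_nonneg (by positivity)] at h
  calc D * Real.log (2 * n + 1) ≤ D * (1 / (4 * D) * (2 * n + 1)) := by gcongr
    _ = (2 * n + 1) / 4 := by field_simp
    _ < n := by linarith

theorem log_example_not_in_gm_star_two
    (r : ℕ) (hr : 3 ≤ r) (a : ℕ → ℝ)
    (ha : ∀ n : ℕ, a n = if r ∣ n then 0 else 1 / ((n : ℝ) * Real.log (n + 1))) :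
    ¬ ∃ K : ℝ, 0 < K ∧ ∃ c : ℝ, 1 < c ∧ ∀ n : ℕ, 1 ≤ n →
      (∑ k ∈ Finset.Icc n (2 * n - 1), |a k - a (k + 2)|) ≤
        K * (a n + a (n + 1) +
          ∑ k ∈ Finset.Icc (max 1 ⌊(n : ℝ) / c⌋₊) ⌊c * (n : ℝ)⌋₊, a k / (k : ℝ)) := by
  rintro ⟨K, hK, c, hc, H⟩
  have hr' : (0 : ℝ) < r := by exact_mod_cast (by omega : 0 < r)
  have hc0 : 0 < c := by linarith
  have hbound : ∀ k : ℕ, 1 ≤ k → a k ≤ 2 / k := fun k hk =>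
    (ha k).trans_le (ite_dvd_inv_mul_log_le r k hk)
  obtain ⟨N, hN⟩ := Filter.eventually_atTop.mp (eventually_mul_log_two_mul_add_one_lt
    (by positivity : 0 < K * (2 + 4 * 2 * c ^ 3) * (2 * r)))
  have hle : N ≤ r * (N + 1) := by nlinarith
  have hlt := hN _ hle
  have hlow := le_sum_abs_sub_add_two hr ha (Nat.le_add_left 1 N)
  have hpos : 1 ≤ r * (N + 1) := Nat.mul_pos (by omega) N.succ_pos
  have hzero : a (r * (N + 1)) = 0 := by rw [ha, if_pos (dvd_mul_right _ _)]
  generalize r * (N + 1) = n at *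
  have hn : (1 : ℝ) ≤ n := by exact_mod_cast hpos
  have hnext : a (n + 1) ≤ 2 / n := (hbound _ (by omega)).trans (by gcongr; omega)
  have hup : 1 / (2 * r * Real.log (2 * n + 1)) ≤ K * (2 + 4 * 2 * c ^ 3) / n :=
    calc _ ≤ _ := hlow.trans (H n hpos)
      _ ≤ K * (0 + 2 / n + 4 * 2 * c ^ 3 / n) := by
        gcongr
        · exact hzero.le
        · exact sum_Icc_div_le zero_le_two hc0 hbound hpos
      _ = _ := by ring
  have hlog : 0 < Real.log (2 * (n : ℝ) + 1) := Real.log_pos (by linarith)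
  rw [div_le_div_iff₀ (by positivity) (by positivity)] at hup
  linarith
end

section
/- Let r ≥ 1 be a natural number, let (a_k)_{k≥1} be a sequence of complex numbers, and let x be a real number with sin(rx/2) ≠ 0 (equivalently, x ≠ 2lπ/r for every integer l). Then for every n ≥ 1: ∑_{k=n}^{2n-1} a_k sin(kx) = −1/(2 sin(rx/2)) · [ ∑_{k=n}^{2n-1} (a_k − a_{k+r}) cos((k + r/2)x) + ∑_{k=2n}^{2n+r-1} a_k cos((k − r/2)x) − ∑_{k=n}^{n+r-1} a_k cos((k − r/2)x) ]. -/
open Finset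

theorem sum_Icc_sub_one_eq_sum_Ico {M : Type*} [AddCommMonoid M] (f : ℕ → M) (m : ℕ) {n : ℕ}
    (hn : 1 ≤ n) : ∑ k ∈ Finset.Icc m (n - 1), f k = ∑ k ∈ Finset.Ico m n, f k := by
  congr 1
  ext k
  simp only [Finset.mem_Icc, Finset.mem_Ico]
  omega

/-- Shifting a window of summation by `r` changes the sum by its two boundary blocks. -/
theorem sum_Ico_sub_sum_Ico_shift {M : Type*} [AddCommGroup M] (f : ℕ → M) {m n : ℕ}
    (hmn : m ≤ n) (r : ℕ) :
    ∑ k ∈ Finset.Ico n (n + r), f k - ∑ k ∈ Finset.Ico m (m + r), f k =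
      ∑ k ∈ Finset.Ico m n, f (k + r) - ∑ k ∈ Finset.Ico m n, f k := by
  rw [Finset.sum_Ico_add' f m n r, sub_eq_sub_iff_add_eq_add,
    add_comm (∑ k ∈ Finset.Ico n (n + r), f k),
    Finset.sum_Ico_consecutive f hmn (Nat.le_add_right n r),
    add_comm (∑ k ∈ Finset.Ico (m + r) (n + r), f k),
    Finset.sum_Ico_consecutive f (Nat.le_add_right m r) (Nat.add_le_add_right hmn r)]

theorem cos_add_half_sub_cos_sub_half (k r x : ℝ) :
    Real.cos ((k + r / 2) * x) - Real.cos ((k - r / 2) * x) =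
      -(2 * Real.sin (r * x / 2) * Real.sin (k * x)) := by
  rw [show (k + r / 2) * x = k * x + r * x / 2 by ring,
    show (k - r / 2) * x = k * x - r * x / 2 by ring, Real.cos_add, Real.cos_sub]
  ring

theorem sine_sum_transform_identity
    (r : ℕ) (hr : 1 ≤ r) (a : ℕ → ℂ) (x : ℝ) (hx : Real.sin (r * x / 2) ≠ 0)
    (n : ℕ) (hn : 1 ≤ n) :
    (∑ k ∈ Finset.Icc n (2 * n - 1), a k * (Real.sin (k * x) : ℂ)) =
      (-1) / (2 * (Real.sin (r * x / 2) : ℂ)) *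
        ((∑ k ∈ Finset.Icc n (2 * n - 1),
            (a k - a (k + r)) * (Real.cos (((k : ℝ) + (r : ℝ) / 2) * x) : ℂ)) +
          (∑ k ∈ Finset.Icc (2 * n) (2 * n + r - 1),
            a k * (Real.cos (((k : ℝ) - (r : ℝ) / 2) * x) : ℂ)) -
          ∑ k ∈ Finset.Icc n (n + r - 1),
            a k * (Real.cos (((k : ℝ) - (r : ℝ) / 2) * x) : ℂ)) := by
  have hs : (Real.sin (r * x / 2) : ℂ) ≠ 0 := Complex.ofReal_ne_zero.mpr hx
  rw [sum_Icc_sub_one_eq_sum_Ico _ _ (by omega), sum_Icc_sub_one_eq_sum_Ico _ _ (by omega),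
    sum_Icc_sub_one_eq_sum_Ico _ _ (by omega), sum_Icc_sub_one_eq_sum_Ico _ _ (by omega),
    add_sub_assoc, sum_Ico_sub_sum_Ico_shift _ (by omega), ← Finset.sum_sub_distrib,
    ← Finset.sum_add_distrib, Finset.mul_sum]
  refine Finset.sum_congr rfl fun k _ => ?_
  have hcos := congrArg (fun y : ℝ => (y : ℂ)) (cos_add_half_sub_cos_sub_half k r x)
  simp only [Complex.ofReal_sub, Complex.ofReal_neg, Complex.ofReal_mul,
    Complex.ofReal_ofNat] at hcos
  have hshift : ((k + r : ℕ) : ℝ) - (r : ℝ) / 2 = k + r / 2 := by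
    push_cast
    ring
  rw [hshift, div_mul_eq_mul_div, eq_div_iff (mul_ne_zero two_ne_zero hs)]
  linear_combination a k * hcos
end
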